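/- arXiv:1510.09193 — 9 statements merged into one kernel-verified Lean document; each statement's English description precedes it below -/
import Mathlib

section
/- Let h(t) = (1-t)·(13/10 - √(t/(1-t))) for t ∈ (0,1/2]. Then the function y ↦ h(e^y) is concave on the interval (-∞, ln(1/2)]. -/
theorem one_sub_mul_sqrt_div_one_sub {t : ℝ} (ht : t < 1) :
    (1 - t) * Real.sqrt (t / (1 - t)) = Real.sqrt (t - t ^ 2) := by
  have h1 : 0 < 1 - t := by linarith
  rw [← Real.sqrt_sq h1.le, ← Real.sqrt_mul (sq_nonneg _), Real.sqrt_sq h1.le]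
  congr 1
  field_simp

theorem hasDerivAt_sqrt_exp_sub_sq {y : ℝ} (hy : 0 < Real.exp y - Real.exp y ^ 2) :
    HasDerivAt (fun y => Real.sqrt (Real.exp y - Real.exp y ^ 2))
      ((Real.exp y - 2 * Real.exp y ^ 2) / (2 * Real.sqrt (Real.exp y - Real.exp y ^ 2))) y := by
  have h := ((Real.hasDerivAt_exp y).sub ((Real.hasDerivAt_exp y).pow 2)).sqrt hy.ne'
  refine h.congr_deriv ?_
  simp only [Pi.sub_apply, Pi.pow_apply]
  push_cast
  ring

theorem second_derivative_bound {t s : ℝ} (ht0 : 0 < t) (ht : t ≤ 1 / 2) (hs0 : 0 < s)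
    (hs : s ^ 2 = t - t ^ 2) :
    -(13 / 10 * t) - ((t - 4 * t ^ 2) * (2 * s) -
      (t - 2 * t ^ 2) * (2 * ((t - 2 * t ^ 2) / (2 * s)))) / (2 * s) ^ 2 ≤ 0 := by
  have hts : t ≤ s := by nlinarith
  have key : 0 ≤ t ^ 2 * (26 / 5 * (1 - t) * s + (1 - 6 * t + 4 * t ^ 2)) := by
    have : 0 ≤ (1 - t) * (s - t) := mul_nonneg (by linarith) (by linarith)
    exact mul_nonneg (sq_nonneg t) (by nlinarith)
  have e : -(13 / 10 * t) - ((t - 4 * t ^ 2) * (2 * s) -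
      (t - 2 * t ^ 2) * (2 * ((t - 2 * t ^ 2) / (2 * s)))) / (2 * s) ^ 2 =
      -(t ^ 2 * (26 / 5 * (1 - t) * s + (1 - 6 * t + 4 * t ^ 2))) / (4 * s ^ 3) := by
    field_simp
    linear_combination (-1040 * s - 400 * (1 - 4 * t)) * hs
  rw [e]
  exact div_nonpos_of_nonpos_of_nonneg (by linarith) (by positivity)

theorem stmt_1 (h : ℝ → ℝ)
    (hh : ∀ t : ℝ, h t = (1 - t) * (13 / 10 - Real.sqrt (t / (1 - t)))) :
    ConcaveOn ℝ (Set.Iic (Real.log (1 / 2))) (fun y : ℝ => h (Real.exp y)) := by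
  have hexp {y : ℝ} (hy : y ≤ Real.log (1 / 2)) : Real.exp y ≤ 1 / 2 :=
    (Real.le_log_iff_exp_le (by norm_num)).1 hy
  have hpos {y : ℝ} (hy : y ≤ Real.log (1 / 2)) : 0 < Real.exp y - Real.exp y ^ 2 := by
    nlinarith [hexp hy, Real.exp_pos y]
  have hconc : ConcaveOn ℝ (Set.Iic (Real.log (1 / 2))) (fun y : ℝ =>
      13 / 10 - 13 / 10 * Real.exp y - Real.sqrt (Real.exp y - Real.exp y ^ 2)) := by
    refine concaveOn_of_hasDerivWithinAt2_nonpos (convex_Iic _)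
      (f' := fun y => -(13 / 10 * Real.exp y) -
        (Real.exp y - 2 * Real.exp y ^ 2) / (2 * Real.sqrt (Real.exp y - Real.exp y ^ 2)))
      (by fun_prop) (fun y hy => ?_) (fun y hy => ?_) (fun y hy => ?_)
      (f'' := fun y => -(13 / 10 * Real.exp y) -
        ((Real.exp y - 4 * Real.exp y ^ 2) * (2 * Real.sqrt (Real.exp y - Real.exp y ^ 2)) -
          (Real.exp y - 2 * Real.exp y ^ 2) * (2 * ((Real.exp y - 2 * Real.exp y ^ 2) /
            (2 * Real.sqrt (Real.exp y - Real.exp y ^ 2))))) /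
              (2 * Real.sqrt (Real.exp y - Real.exp y ^ 2)) ^ 2)
    all_goals
      have hy := interior_subset hy
      have hs := Real.sqrt_pos.2 (hpos hy)
    · exact ((((Real.hasDerivAt_exp y).const_mul (13 / 10)).const_sub (13 / 10)).sub
        (hasDerivAt_sqrt_exp_sub_sq (hpos hy))).hasDerivWithinAt
    · have hnum : HasDerivAt (fun y => Real.exp y - 2 * Real.exp y ^ 2)
          (Real.exp y - 4 * Real.exp y ^ 2) y := by
        refine ((Real.hasDerivAt_exp y).sub
          (((Real.hasDerivAt_exp y).pow 2).const_mul 2)).congr_deriv ?_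
        push_cast
        ring
      exact (((Real.hasDerivAt_exp y).const_mul (13 / 10)).neg.sub (hnum.div
        ((hasDerivAt_sqrt_exp_sub_sq (hpos hy)).const_mul 2) (by positivity))).hasDerivWithinAt
    · exact second_derivative_bound (Real.exp_pos y) (hexp hy) hs (Real.sq_sqrt (hpos hy).le)
  refine hconc.congr fun y hy => ?_
  have hy1 : Real.exp y < 1 := by linarith [hexp hy]
  simp only [hh]
  rw [mul_sub, one_sub_mul_sqrt_div_one_sub hy1]
  ring
end

section
/- Let ψ = 13/10 and α = 1 - 10⁻⁴. For every real r with 0 ≤ r ≤ 1, (1/(ψ - 1/√(1+r))) · (r·(ψ - √r))/(α·(1+r)) ≤ 42/100. -/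
/-- The inequality with denominators cleared, in terms of `s = √r` and `t = √(1 + r)`. -/
theorem cleared_bound (s t : ℝ) (hs : 0 ≤ s) (hst : t ^ 2 = 1 + s ^ 2) :
    s ^ 2 * (13 / 10 - s) ≤
      42 / 100 * ((1 - 1 / 10 ^ 4) * (13 / 10 * t ^ 2 - t)) := by
  have tangent : t ≤ (1 + s ^ 2 + 1.1776 ^ 2) / (2 * 1.1776) := by
    rw [le_div_iff₀ (by norm_num)]
    nlinarith [sq_nonneg (t - 1.1776)]
  have cubic : 0 ≤ (s - 0.6216) ^ 2 * (s + 0.3108) := by positivity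
  rw [hst]
  nlinarith [sq_nonneg s]

theorem stmt_2 (ψ α : ℝ) (hψ : ψ = 13 / 10) (hα : α = 1 - 1 / 10 ^ 4)
    (r : ℝ) (h0 : 0 ≤ r) (h1 : r ≤ 1) :
    (1 / (ψ - 1 / Real.sqrt (1 + r))) * ((r * (ψ - Real.sqrt r)) / (α * (1 + r))) ≤
      42 / 100 := by
  subst hψ hα
  have hsr : Real.sqrt r ^ 2 = r := Real.sq_sqrt h0
  have htr : Real.sqrt (1 + r) ^ 2 = 1 + r := Real.sq_sqrt (by linarith)
  have ht1 : 1 ≤ Real.sqrt (1 + r) := Real.one_le_sqrt.mpr (by linarith)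
  have key := cleared_bound (Real.sqrt r) (Real.sqrt (1 + r)) (Real.sqrt_nonneg r)
    (by rw [hsr, htr])
  rw [hsr] at key
  generalize Real.sqrt (1 + r) = t at *
  rw [← htr]
  have ht0 : 0 < t := by linarith
  have hfac : (13 / 10 - 1 / t) * t ^ 2 = 13 / 10 * t ^ 2 - t := by
    field_simp
  have hpos : 0 < 13 / 10 - 1 / t := by
    have : 1 / t ≤ 1 := (div_le_one ht0).mpr ht1
    linarith
  rw [div_mul_div_comm, one_mul, div_le_iff₀ (mul_pos hpos (mul_pos (by norm_num) (by positivity)))]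
  linear_combination key - 42 / 100 * (1 - 1 / 10 ^ 4) * hfac
end

section
/- Let c = 7/10, ψ = 13/10, α = 1 - 10⁻⁴, and for a positive integer w let l_w = ⌈log₆(w+1)⌉. For an integer w ≥ 2 and real y with √(1-2^{-w}) ≤ y < 1, define g(y,w) = c^{-w}·α^{-l_w}·w·((1-y²)/y²)·(1-(1-y²)^{1/w})·(ψ - √((1-y²)^{1/w}/(1-(1-y²)^{1/w}))). Set K₂ = 111614/10⁵, K₃ = 103/100, K₄ = 101/100, and K_w = 1 for all integers w ≥ 5. Then for every integer w ≥ 2 and every y ∈ [√(1-2^{-w}), 1): g(y,w) ≤ K_w · (15/100)·α^{-l_w}·w·(2c)^{-w}·(1-2^{-w})^{-1} (the right-hand side equals K_w·g(√(1-2^{-w}), w)). -/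
noncomputable def stmt3K (w : ℕ) : ℝ :=
  if w = 2 then 111614 / 10 ^ 5
  else if w = 3 then 103 / 100
  else if w = 4 then 101 / 100
  else 1

theorem mul_pow_le_mul_sub_pow {u : ℝ} (h0 : 0 ≤ u) (h1 : u ≤ 1) (w : ℕ) :
    (2 ^ w - 1) * u ^ w ≤ u * ((1 + u) ^ w - u ^ w) := by
  induction w with
  | zero => simp
  | succ n ih =>
    have hA : (0 : ℝ) ≤ 2 ^ n - 1 := sub_nonneg.2 (one_le_pow₀ (by norm_num))
    have hu : 0 ≤ u ^ n := pow_nonneg h0 n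
    have key := mul_le_mul_of_nonneg_left ih (by linarith : 0 ≤ 1 + u)
    have h2 := mul_nonneg (mul_nonneg hA hu) (by linarith : 0 ≤ 1 - u)
    simp only [pow_succ] at *
    nlinarith

theorem sub_pow_le_mul_add {u : ℝ} (h0 : 0 ≤ u) (h1 : u ≤ 1) {w : ℕ} (hw : 1 ≤ w) :
    u * ((1 + u) ^ w - u ^ w) ≤
      (2 ^ w - 1) * ((1 - u) * ((1 + u) ^ w - u ^ w) + u ^ w) := by
  induction w, hw using Nat.le_induction with
  | base => norm_num; linarith
  | succ n hn ih =>
    have hu : 0 ≤ u ^ n := pow_nonneg h0 n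
    have hA := mul_pow_le_mul_sub_pow h0 h1 n
    have hD : 0 ≤ (1 + u) ^ n - u ^ n :=
      sub_nonneg.2 (pow_le_pow_left₀ h0 (by linarith) n)
    have hE : (1 + u) ^ (n + 1) - u ^ (n + 1) =
        (1 + u) * ((1 + u) ^ n - u ^ n) + u ^ n := by ring
    rw [hE]
    simp only [pow_succ]
    generalize (1 + u) ^ n - u ^ n = D at *
    generalize u ^ n = p at *
    generalize (2 : ℝ) ^ n = B at *
    have e1 := mul_le_mul_of_nonneg_left ih (by linarith : 0 ≤ 2 * (1 + u))
    have e2 := mul_le_mul_of_nonneg_left hA (by linarith : 0 ≤ 2 * u)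
    have e3 : 0 ≤ u * (1 - u) * D := by
      have : 0 ≤ 1 - u := by linarith
      positivity
    have e4 : 0 ≤ (1 + u) * (1 - u) * D := by
      have : 0 ≤ 1 - u := by linarith
      positivity
    have e5 : 0 ≤ (1 - u) * p := mul_nonneg (by linarith) hu
    nlinarith

theorem pow_mul_le_of_five_le {s : ℝ} (h0 : 0 ≤ s) (h1 : s ≤ 1) {w : ℕ} (hw : 5 ≤ w) :
    (2 ^ w - 1) * (s ^ 2) ^ w * (13 / 10 - s) ≤
      15 / 100 * (1 + s ^ 2) * ((1 + s ^ 2) ^ w - (s ^ 2) ^ w) := by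
  induction w, hw using Nat.le_induction with
  | base =>
    have hk : ∀ k ≤ 10, s ^ 10 ≤ s ^ k := fun k hk => pow_le_pow_of_le_one h0 h1 hk
    have hq : 0 ≤ 15 / 100 + 15 / 100 * s + 105 / 100 * s ^ 2 + 105 / 100 * s ^ 3
        + 33 / 10 * s ^ 4 + 33 / 10 * s ^ 5 + 63 / 10 * s ^ 6 + 63 / 10 * s ^ 7
        + 855 / 100 * s ^ 8 + 855 / 100 * s ^ 9 - 31 * s ^ 10 := by
      have p4 := hk 4 (by norm_num)
      have p5 := hk 5 (by norm_num)
      have p6 := hk 6 (by norm_num)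
      have p7 := hk 7 (by norm_num)
      have p8 := hk 8 (by norm_num)
      have p9 := hk 9 (by norm_num)
      have p2 := hk 2 (by norm_num)
      have p3 := hk 3 (by norm_num)
      have p10 : 0 ≤ s ^ 10 := by positivity
      linarith
    have := mul_nonneg (sub_nonneg.2 h1) hq
    nlinarith
  | succ n hn ih =>
    have hu0 : 0 ≤ s ^ 2 := by positivity
    have hu1 : s ^ 2 ≤ 1 := pow_le_one₀ h0 h1
    have key := sub_pow_le_mul_add hu0 hu1 (by omega : 1 ≤ n)
    generalize s ^ 2 = u at *
    have hp : 0 ≤ u ^ n := pow_nonneg hu0 n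
    have hD : 0 < (1 + u) ^ n - u ^ n :=
      sub_pos.2 (pow_lt_pow_left₀ (by linarith) hu0 (by omega))
    have hE : (1 + u) ^ (n + 1) - u ^ (n + 1) =
        (1 + u) * ((1 + u) ^ n - u ^ n) + u ^ n := by ring
    rw [hE]
    simp only [pow_succ]
    generalize (1 + u) ^ n - u ^ n = D at *
    generalize u ^ n = p at *
    generalize (2 : ℝ) ^ n = B at *
    refine le_of_mul_le_mul_right ?_ hD
    have hs : 0 ≤ p * (13 / 10 - s) := mul_nonneg hp (by linarith)
    have e1 := mul_le_mul_of_nonneg_left key hs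
    have e2 := mul_le_mul_of_nonneg_left ih (by positivity : 0 ≤ (1 + u) * D + p)
    nlinarith

theorem pow_mul_le_stmt3K {s : ℝ} (h0 : 0 ≤ s) (h1 : s ≤ 1) {w : ℕ} (hw : 2 ≤ w) :
    (2 ^ w - 1) * (s ^ 2) ^ w * (13 / 10 - s) ≤
      stmt3K w * (15 / 100) * (1 + s ^ 2) * ((1 + s ^ 2) ^ w - (s ^ 2) ^ w) := by
  obtain rfl | rfl | rfl | h5 : w = 2 ∨ w = 3 ∨ w = 4 ∨ 5 ≤ w := by omega
  · norm_num [stmt3K]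
    have h := mul_nonneg (sq_nonneg (s - 43 / 50))
      (by positivity : 0 ≤ 155703037 / 1250000000 + 6554103 / 12500000 * s + 797421 / 500000 * s ^ 2 +
        3 * s ^ 3)
    nlinarith [sq_nonneg (s - (86773 / 100000))]
  · norm_num [stmt3K]
    have h := mul_nonneg (sq_nonneg (s - 47 / 50))
      (by positivity : 0 ≤ 211421439 / 2500000000 + 23476171 / 62500000 * s + 6448589 / 5000000 * s ^ 2 +
        115949 / 50000 * s ^ 3 + 9047 / 2000 * s ^ 4 + 7 * s ^ 5)
    nlinarith [sq_nonneg (s - (43227 / 50000))]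
  · norm_num [stmt3K]
    have h := mul_nonneg (sq_nonneg (s - 497 / 500))
      (by positivity : 0 ≤ 196945142888875519 / 7812500000000000000 + 3687417185450271 / 15625000000000000 * s +
        6967411138419 / 6250000000000 * s ^ 2 + 125261088351 / 62500000000 * s ^ 3 +
        554701311 / 125000000 * s ^ 4 + 1725087 / 250000 * s ^ 5 +
        5463 / 500 * s ^ 6 + 15 * s ^ 7)
    nlinarith [sq_nonneg (s - (11441 / 12500))]
  · have hK : stmt3K w = 1 := by
      simp only [stmt3K]
      rw [if_neg (by omega), if_neg (by omega), if_neg (by omega)]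
    rw [hK, one_mul]
    exact pow_mul_le_of_five_le h0 h1 h5

theorem stmt_3 (c ψ α : ℝ) (hc : c = 7 / 10) (hψ : ψ = 13 / 10)
    (hα : α = 1 - 1 / 10 ^ 4)
    (l : ℕ → ℤ) (hl : ∀ v : ℕ, l v = ⌈Real.logb 6 (v + 1)⌉)
    (w : ℕ) (hw : 2 ≤ w) (y : ℝ)
    (hy1 : Real.sqrt (1 - 2 ^ (-(w : ℤ))) ≤ y) (hy2 : y < 1) :
    c ^ (-(w : ℤ)) * α ^ (-(l w)) * w * ((1 - y ^ 2) / y ^ 2) *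
        (1 - (1 - y ^ 2) ^ ((1 : ℝ) / w)) *
        (ψ - Real.sqrt ((1 - y ^ 2) ^ ((1 : ℝ) / w) / (1 - (1 - y ^ 2) ^ ((1 : ℝ) / w)))) ≤
      stmt3K w *
        ((15 / 100) * α ^ (-(l w)) * w * (2 * c) ^ (-(w : ℤ)) *
          (1 - 2 ^ (-(w : ℤ)))⁻¹) := by
  have hw0 : w ≠ 0 := by omega
  have hc0 : 0 < c := by rw [hc]; norm_num
  have hα0 : 0 < α := by rw [hα]; norm_num
  have hB : (1 : ℝ) < 2 ^ w := one_lt_pow₀ (by norm_num) hw0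
  have hy0 : 0 ≤ y := (Real.sqrt_nonneg _).trans hy1
  have hyl := (Real.sqrt_le_left hy0).1 hy1
  simp only [zpow_neg, zpow_natCast] at hyl ⊢
  have ht0 : 0 < 1 - y ^ 2 := by nlinarith
  set z := (1 - y ^ 2) ^ ((1 : ℝ) / w) with hz
  have hz0 : 0 < z := Real.rpow_pos_of_pos ht0 _
  have hzw : z ^ w = 1 - y ^ 2 := by
    rw [hz, one_div, Real.rpow_inv_natCast_pow ht0.le hw0]
  have hz1 : z ≤ 1 / 2 := by
    refine le_of_pow_le_pow_left₀ hw0 (by norm_num) ?_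
    rw [hzw, one_div, inv_pow]
    linarith
  have hz2 : 0 < 1 - z := by linarith
  set s := Real.sqrt (z / (1 - z)) with hs
  have hs0 : 0 ≤ s := Real.sqrt_nonneg _
  have hss : s ^ 2 = z / (1 - z) := Real.sq_sqrt (by positivity)
  have hs1 : s ≤ 1 := by
    rw [hs, Real.sqrt_le_one, div_le_one hz2]
    linarith
  have key := pow_mul_le_stmt3K hs0 hs1 hw
  have h1 : 1 + s ^ 2 = 1 / (1 - z) := by rw [hss]; field_simp; ring
  rw [h1, hss, div_pow, div_pow, one_pow, hzw, ← hψ] at key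
  have hy : 0 < y ^ 2 := by
    have : (2 ^ w : ℝ)⁻¹ < 1 := inv_lt_one_of_one_lt₀ hB
    linarith
  have hy' : y ≠ 0 := by rintro rfl; simp at hy
  have hmain : (1 - y ^ 2) / y ^ 2 * (1 - z) * (ψ - s) ≤
      stmt3K w * (15 / 100) / (2 ^ w - 1) := by
    rw [le_div_iff₀ (by linarith)]
    have hp : 0 < (1 - z) ^ w := pow_pos hz2 w
    have := mul_le_mul_of_nonneg_left key
      (by positivity : 0 ≤ (1 - z) ^ w * (1 - z) / y ^ 2)
    convert this using 1
    · field_simp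
    · field_simp
      ring_nf
  have hpos : 0 ≤ (c ^ w)⁻¹ * (α ^ l w)⁻¹ * w := by positivity
  have hB' : (2 : ℝ) ^ w - 1 ≠ 0 := by linarith
  calc _ = (c ^ w)⁻¹ * (α ^ l w)⁻¹ * w * ((1 - y ^ 2) / y ^ 2 * (1 - z) * (ψ - s)) := by
        ring
    _ ≤ (c ^ w)⁻¹ * (α ^ l w)⁻¹ * w * (stmt3K w * (15 / 100) / (2 ^ w - 1)) :=
        mul_le_mul_of_nonneg_left hmain hpos
    _ = _ := by
        rw [mul_pow]
        field_simp
end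

section
/- Let δ = 9789/10000, α = 1 - 10⁻⁴, M = 25/1000, l_w = ⌈log₆(w+1)⌉, and h(t) = (1-t)·(13/10 - √(t/(1-t))) for t ∈ [0,1/2]. Then for every integer w ≥ 6 and every t ∈ [0,1/2], it holds that w·δ^{-5(w-1)}·α^{-l_w}·(t^w/(1-t^w))·h(t) ≤ M/α. -/
/-- The polynomial `t ^ 6 * (1 - t) * (13 / 10 - 2 * t)` is maximal on `[0, 1/2]` at `1/2`. -/
lemma pow_six_mul_le {t : ℝ} (ht0 : 0 ≤ t) (ht1 : t ≤ 1 / 2) :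
    t ^ 6 * ((1 - t) * (13 / 10 - 2 * t)) ≤ 3 / 1280 := by
  have hj (i j : ℕ) : t ^ i * t ^ j ≤ t ^ i * (1 / 2) ^ j := by gcongr
  have h4 := hj 4 1
  have h3 := hj 3 2
  have h2 := hj 2 3
  have h1 := hj 1 4
  have h0 := hj 0 5
  have hquad : 0 ≤ t ^ 5 * (9 / 10 - 23 / 10 * t + 2 * t ^ 2) := by
    have : 0 ≤ 9 / 10 - 23 / 10 * t + 2 * t ^ 2 := by nlinarith [sq_nonneg (t - 23 / 40)]
    positivity
  have hq : 0 ≤ 3 / 20 * (t ^ 5 + t ^ 4 * (1 / 2) + t ^ 3 * (1 / 2) ^ 2 + t ^ 2 * (1 / 2) ^ 3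
      + t * (1 / 2) ^ 4 + (1 / 2) ^ 5) - 23 / 10 * t ^ 6 + 2 * t ^ 7 := by
    ring_nf at h4 h3 h2 h1 h0 hquad ⊢
    linarith
  have hprod := mul_nonneg (sub_nonneg.2 ht1) hq
  ring_nf at hprod ⊢
  linarith

lemma two_mul_le_sqrt_div_one_sub {t : ℝ} (ht0 : 0 ≤ t) (ht1 : t ≤ 1 / 2) :
    2 * t ≤ √(t / (1 - t)) := by
  apply Real.le_sqrt_of_sq_le
  rw [le_div_iff₀ (by linarith)]
  nlinarith [mul_nonneg ht0 (sq_nonneg (2 * t - 1))]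

lemma sqrt_div_one_sub_le_one {t : ℝ} (ht1 : t ≤ 1 / 2) : √(t / (1 - t)) ≤ 1 := by
  rw [Real.sqrt_le_iff, and_iff_right zero_le_one, one_pow, div_le_one (by linarith)]
  linarith

lemma ceil_logb_six_le (n : ℕ) : ⌈Real.logb 6 ((n + 6 : ℕ) + 1)⌉ ≤ (n + 2 : ℕ) := by
  have hpow : n + 7 ≤ 6 ^ (n + 2) := by
    induction n with
    | zero => norm_num
    | succ k ih => rw [show k + 1 + 2 = (k + 2) + 1 by ring, pow_succ]; omega
  rw [Int.ceil_le, Real.logb_le_iff_le_rpow (by norm_num) (by positivity), Int.cast_natCast,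
    Real.rpow_natCast]
  have hreal : ((n + 7 : ℕ) : ℝ) ≤ ((6 ^ (n + 2) : ℕ) : ℝ) := Nat.cast_le.2 hpow
  push_cast at hreal ⊢
  linarith

lemma add_six_mul_pow_le {r : ℝ} (hr0 : 0 ≤ r) (hr : r ≤ 6 / 7) (n : ℕ) :
    (n + 6) * r ^ n ≤ 6 := by
  induction n with
  | zero => norm_num
  | succ k ih =>
    have hk : ((k : ℝ) + 1 + 6) * r ≤ k + 6 := by
      have hk0 : (0 : ℝ) ≤ k := k.cast_nonneg
      nlinarith
    calc ((k + 1 : ℕ) + 6 : ℝ) * r ^ (k + 1) = (((k : ℝ) + 1 + 6) * r) * r ^ k := by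
          push_cast; ring
      _ ≤ (k + 6) * r ^ k := by gcongr
      _ ≤ 6 := ih

lemma pow_div_one_sub_pow_le {t : ℝ} (ht0 : 0 ≤ t) (ht1 : t ≤ 1 / 2) (n : ℕ) :
    t ^ (n + 6) / (1 - t ^ (n + 6)) ≤ (1 / 2) ^ n * (64 / 63 * t ^ 6) := by
  have hle : t ^ (n + 6) ≤ (1 / 2) ^ n * t ^ 6 := by rw [pow_add]; gcongr
  have hsmall : t ^ (n + 6) ≤ 1 / 64 :=
    calc t ^ (n + 6) ≤ t ^ 6 := pow_le_pow_of_le_one ht0 (by linarith) (by omega)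
      _ ≤ (1 / 2) ^ 6 := by gcongr
      _ = 1 / 64 := by norm_num
  rw [div_le_iff₀ (by linarith)]
  have hnonneg : 0 ≤ (1 / 2) ^ n * t ^ 6 := by positivity
  nlinarith

theorem stmt_10 (δ α M : ℝ) (hδ : δ = 9789 / 10000) (hα : α = 1 - 1 / 10 ^ 4)
    (hM : M = 25 / 1000)
    (l : ℕ → ℤ) (hl : ∀ v : ℕ, l v = ⌈Real.logb 6 (v + 1)⌉)
    (h : ℝ → ℝ) (hh : ∀ u : ℝ, h u = (1 - u) * (13 / 10 - Real.sqrt (u / (1 - u))))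
    (w : ℕ) (hw : 6 ≤ w) (t : ℝ) (ht0 : 0 ≤ t) (ht1 : t ≤ 1 / 2) :
    w * δ ^ (-(5 * ((w : ℤ) - 1))) * α ^ (-(l w)) * (t ^ w / (1 - t ^ w)) * h t ≤
      M / α := by
  obtain ⟨n, rfl⟩ := Nat.exists_eq_add_of_le' hw
  have hδpow : δ ^ (-(5 * (((n + 6 : ℕ) : ℤ) - 1))) = (δ⁻¹ ^ 5) ^ (n + 5) := by
    rw [← pow_mul, ← zpow_natCast, inv_zpow']
    congr 1
    push_cast
    ring
  have hαpow : α ^ (-(l (n + 6))) ≤ α⁻¹ ^ (n + 2) := by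
    rw [← inv_zpow', ← zpow_natCast]
    apply zpow_le_zpow_right₀
    · rw [hα]; norm_num
    · rw [hl]; exact ceil_logb_six_le n
  have hδ0 : 0 < δ := by rw [hδ]; norm_num
  have hα0 : 0 < α := by rw [hα]; norm_num
  have hh0 : 0 ≤ h t := by
    rw [hh]
    exact mul_nonneg (by linarith) (by linarith [sqrt_div_one_sub_le_one ht1])
  have hh1 : h t ≤ (1 - t) * (13 / 10 - 2 * t) := by
    rw [hh]
    exact mul_le_mul_of_nonneg_left (by linarith [two_mul_le_sqrt_div_one_sub ht0 ht1])
      (by linarith)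
  have hth : t ^ 6 * h t ≤ 3 / 1280 :=
    (mul_le_mul_of_nonneg_left hh1 (by positivity)).trans (pow_six_mul_le ht0 ht1)
  have hgrowth := add_six_mul_pow_le (r := δ⁻¹ ^ 5 * α⁻¹ * (1 / 2)) (by positivity)
    (by rw [hδ, hα]; norm_num) n
  rw [hδpow]
  calc ((n + 6 : ℕ) : ℝ) * (δ⁻¹ ^ 5) ^ (n + 5) * α ^ (-(l (n + 6)))
        * (t ^ (n + 6) / (1 - t ^ (n + 6))) * h t
      ≤ ((n + 6 : ℕ) : ℝ) * (δ⁻¹ ^ 5) ^ (n + 5) * α⁻¹ ^ (n + 2)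
        * ((1 / 2) ^ n * (64 / 63 * t ^ 6)) * h t := by
        apply mul_le_mul_of_nonneg_right _ hh0
        apply (mul_le_mul_of_nonneg_left (pow_div_one_sub_pow_le ht0 ht1 n)
          (by positivity)).trans
        gcongr
    _ = ((n + 6) * (δ⁻¹ ^ 5 * α⁻¹ * (1 / 2)) ^ n)
        * ((δ⁻¹ ^ 5) ^ 5 * α⁻¹ ^ 2 * (64 / 63)) * (t ^ 6 * h t) := by
        push_cast
        simp only [mul_pow, pow_add]
        ring
    _ ≤ 6 * ((δ⁻¹ ^ 5) ^ 5 * α⁻¹ ^ 2 * (64 / 63)) * (3 / 1280) := by gcongr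
    _ ≤ M / α := by rw [hδ, hα, hM]; norm_num
end

section
/- Let h(t) = (1-t)·(13/10 - √(t/(1-t))) for t ∈ [0,1/2], and for a positive integer w define g_w(y) = ((1-y)/y)·h((1-y)^{1/w}) for y ∈ [1-2^{-w}, 1]. Then for each w ∈ {1,2,3,4,5}, the function z ↦ g_w(e^z) is concave on the interval [ln(1-2^{-w}), 0]. -/
/-- The factor `(1 - t) * (13/10 - √(t / (1 - t)))`, written without the quotient. -/
noncomputable def bFun (t : ℝ) : ℝ := 13 / 10 * (1 - t) - √(t * (1 - t))

/-- The derivative of `bFun` on `(0, 1)`. -/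
noncomputable def bFunDeriv (t : ℝ) : ℝ := -(13 / 10) - (1 - 2 * t) / (2 * √(t * (1 - t)))

/-- The derivative of `t ^ w / (1 - t ^ w) * bFun t`, up to the factor
`t ^ (w - 1) / (1 - t ^ w)`. -/
noncomputable def slopeFun (w : ℕ) (t : ℝ) : ℝ := w * bFun t / (1 - t ^ w) + t * bFunDeriv t

/-- The derivative of `slopeFun w` on `(0, 1)`. -/
noncomputable def slopeFunDeriv (w : ℕ) (t : ℝ) : ℝ :=
  w * bFunDeriv t / (1 - t ^ w) + w ^ 2 * t ^ (w - 1) * bFun t / (1 - t ^ w) ^ 2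
    + bFunDeriv t + 1 / (4 * √(t * (1 - t)) * (1 - t))

/-- The parameter `t = (1 - exp z) ^ (1 / w)`. -/
noncomputable def rootParam (w : ℕ) (z : ℝ) : ℝ := (1 - Real.exp z) ^ ((1 : ℝ) / w)

lemma hasDerivAt_sqrt_mul_one_sub {t : ℝ} (h0 : 0 < t) (h1 : t < 1) :
    HasDerivAt (fun t : ℝ => √(t * (1 - t))) ((1 - 2 * t) / (2 * √(t * (1 - t)))) t := by
  have hp : t * (1 - t) ≠ 0 := (mul_pos h0 (by linarith)).ne'
  have h : HasDerivAt (fun t : ℝ => t * (1 - t)) (1 - 2 * t) t := by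
    refine ((hasDerivAt_id' t).mul ((hasDerivAt_id' t).const_sub 1)).congr_deriv ?_
    ring
  exact h.sqrt hp

lemma hasDerivAt_bFun {t : ℝ} (h0 : 0 < t) (h1 : t < 1) :
    HasDerivAt bFun (bFunDeriv t) t := by
  refine ((((hasDerivAt_id' t).const_sub 1).const_mul (13 / 10)).sub
    (hasDerivAt_sqrt_mul_one_sub h0 h1)).congr_deriv ?_
  simp only [bFunDeriv]
  ring

lemma hasDerivAt_bFunDeriv {t : ℝ} (h0 : 0 < t) (h1 : t < 1) :
    HasDerivAt bFunDeriv (1 / (4 * √(t * (1 - t)) * (t * (1 - t)))) t := by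
  have hp : 0 < t * (1 - t) := mul_pos h0 (by linarith)
  have hs : 0 < √(t * (1 - t)) := Real.sqrt_pos.2 hp
  have hsq : √(t * (1 - t)) ^ 2 = t * (1 - t) := Real.sq_sqrt hp.le
  have hnum : HasDerivAt (fun t : ℝ => 1 - 2 * t) (-2) t := by
    refine (((hasDerivAt_id' t).const_mul 2).const_sub 1).congr_deriv ?_
    ring
  refine ((hnum.div ((hasDerivAt_sqrt_mul_one_sub h0 h1).const_mul 2)
    (by positivity)).const_sub (-(13 / 10))).congr_deriv ?_
  set s := √(t * (1 - t))
  rw [← hsq]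
  field_simp
  linear_combination 16 * hsq

lemma hasDerivAt_slopeFun {w : ℕ} (hw : w ≠ 0) {t : ℝ} (h0 : 0 < t) (h1 : t < 1) :
    HasDerivAt (slopeFun w) (slopeFunDeriv w t) t := by
  have hq : 1 - t ^ w ≠ 0 := (sub_pos.2 (pow_lt_one₀ h0.le h1 hw)).ne'
  have hp : 0 < 1 - t := by linarith
  have hs : 0 < √(t * (1 - t)) := Real.sqrt_pos.2 (mul_pos h0 hp)
  refine ((((hasDerivAt_bFun h0 h1).const_mul (w : ℝ)).div
    ((hasDerivAt_pow w t).const_sub 1) hq).add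
    ((hasDerivAt_id' t).mul (hasDerivAt_bFunDeriv h0 h1))).congr_deriv ?_
  simp only [slopeFunDeriv]
  field_simp
  ring

lemma hasDerivAt_pow_div_mul_bFun {w : ℕ} (hw : w ≠ 0) {t : ℝ} (h0 : 0 < t) (h1 : t < 1) :
    HasDerivAt (fun t => t ^ w / (1 - t ^ w) * bFun t)
      (t ^ w / (t * (1 - t ^ w)) * slopeFun w t) t := by
  have hq : 1 - t ^ w ≠ 0 := (sub_pos.2 (pow_lt_one₀ h0.le h1 hw)).ne'
  refine (((hasDerivAt_pow w t).div ((hasDerivAt_pow w t).const_sub 1) hq).mul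
    (hasDerivAt_bFun h0 h1)).congr_deriv ?_
  obtain ⟨n, rfl⟩ := Nat.exists_eq_succ_of_ne_zero hw
  simp only [slopeFun, Pi.div_apply, Nat.succ_eq_add_one, Nat.add_sub_cancel, pow_succ] at hq ⊢
  field_simp
  ring

lemma mul_pow_mul_one_sub_le (w : ℕ) {t : ℝ} (h0 : 0 ≤ t) (h1 : t ≤ 1) :
    w * t ^ w * (1 - t) ≤ t * (1 - t ^ w) := by
  induction w with
  | zero => simp
  | succ n ih =>
    have hn : t ^ n ≤ 1 := pow_le_one₀ h0 h1
    have hn0 : 0 ≤ t ^ n := pow_nonneg h0 n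
    have h := mul_le_mul_of_nonneg_left ih h0
    have h' : 0 ≤ t * (1 - t) * (1 - t ^ n) :=
      mul_nonneg (mul_nonneg h0 (by linarith)) (by linarith)
    push_cast
    rw [pow_succ]
    nlinarith

lemma slopeFunDeriv_nonpos {w : ℕ} (hw : w ≠ 0) {t : ℝ} (h0 : 0 < t) (h1 : t ≤ 1 / 2) :
    slopeFunDeriv w t ≤ 0 := by
  have hq : 0 < 1 - t ^ w := sub_pos.2 (pow_lt_one₀ h0.le (by linarith) hw)
  have hp : 0 < 1 - t := by linarith
  have hw0 : (0 : ℝ) < w := by positivity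
  have hs : 0 < √(t * (1 - t)) := Real.sqrt_pos.2 (mul_pos h0 hp)
  have hsq : √(t * (1 - t)) ^ 2 = t * (1 - t) := Real.sq_sqrt (mul_pos h0 hp).le
  have hts : t ≤ √(t * (1 - t)) := Real.le_sqrt_of_sq_le (by nlinarith)
  have hber : w * t ^ (w - 1) * (1 - t) ≤ 1 - t ^ w := by
    have h := mul_pow_mul_one_sub_le w h0.le (by linarith : t ≤ 1)
    rw [← mul_pow_sub_one hw t] at h ⊢
    nlinarith
  have hinv : 1 / (4 * (1 - t)) ≤ 1 / 2 := by
    rw [div_le_div_iff₀ (by positivity) (by norm_num)]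
    linarith
  set q := 1 - t ^ w
  set c := t ^ (w - 1)
  have key : slopeFunDeriv w t = (-(w * q + q ^ 2) * (13 / 10 * √(t * (1 - t)) + (1 - 2 * t) / 2)
      + w * (w * c * (1 - t)) * (13 / 10 * √(t * (1 - t)) - t)
      + q ^ 2 * (1 / (4 * (1 - t)))) / (q ^ 2 * √(t * (1 - t))) := by
    simp only [slopeFunDeriv, bFun, bFunDeriv]
    change _ * _ / q + _ * c * _ / q ^ 2 + _ + _ = _
    set s := √(t * (1 - t))
    field_simp
    linear_combination (-(80 * w ^ 2 * c * (1 - t))) * hsq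
  rw [key]
  refine div_nonpos_of_nonpos_of_nonneg ?_ (by positivity)
  set s := √(t * (1 - t))
  have h1' : w * (w * c * (1 - t)) * (13 / 10 * s - t) ≤ w * q * (13 / 10 * s - t) :=
    mul_le_mul_of_nonneg_right (mul_le_mul_of_nonneg_left hber hw0.le) (by linarith)
  have h2' : q ^ 2 * (1 / (4 * (1 - t))) ≤ q ^ 2 * (1 / 2) :=
    mul_le_mul_of_nonneg_left hinv (by positivity)
  have h3' : 0 ≤ q ^ 2 * (13 / 10 * s - t) := mul_nonneg (by positivity) (by linarith)
  have h4' : 0 < w * q := by positivity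
  nlinarith

lemma rootParam_pow {w : ℕ} (hw : w ≠ 0) {z : ℝ} (hz : z ≤ 0) :
    rootParam w z ^ w = 1 - Real.exp z := by
  have h : 0 ≤ 1 - Real.exp z := sub_nonneg.2 (Real.exp_le_one_iff.2 hz)
  rw [rootParam, one_div, Real.rpow_inv_natCast_pow h hw]

lemma rootParam_nonneg (w : ℕ) {z : ℝ} (hz : z ≤ 0) : 0 ≤ rootParam w z :=
  Real.rpow_nonneg (sub_nonneg.2 (Real.exp_le_one_iff.2 hz)) _

lemma rootParam_pos (w : ℕ) {z : ℝ} (hz : z < 0) : 0 < rootParam w z :=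
  Real.rpow_pos_of_pos (sub_pos.2 (Real.exp_lt_one_iff.2 hz)) _

lemma rootParam_le_half {w : ℕ} (hw : w ≠ 0) {z : ℝ}
    (hz : Real.log (1 - 2 ^ (-(w : ℤ))) ≤ z) (hz0 : z ≤ 0) : rootParam w z ≤ 1 / 2 := by
  have e : (2 : ℝ) ^ (-(w : ℤ)) = (1 / 2) ^ w := by
    rw [zpow_neg, zpow_natCast, one_div, inv_pow]
  rw [e] at hz
  have hlt : (1 / 2 : ℝ) ^ w < 1 := pow_lt_one₀ (by norm_num) (by norm_num) hw
  have h := (Real.log_le_iff_le_exp (by linarith)).1 hz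
  refine le_of_pow_le_pow_left₀ hw (by norm_num) ?_
  rw [rootParam_pow hw hz0]
  linarith

lemma hasDerivAt_rootParam {w : ℕ} (hw : w ≠ 0) {z : ℝ} (hz : z < 0) :
    HasDerivAt (rootParam w)
      (-((1 - rootParam w z ^ w) * rootParam w z / (w * rootParam w z ^ w))) z := by
  have h : 0 < 1 - Real.exp z := sub_pos.2 (Real.exp_lt_one_iff.2 hz)
  refine (((Real.hasDerivAt_exp z).const_sub 1).rpow_const (p := (1 : ℝ) / w)
    (Or.inl h.ne')).congr_deriv ?_
  rw [rootParam_pow hw hz.le, rootParam, Real.rpow_sub_one h.ne']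
  have hw0 : (w : ℝ) ≠ 0 := Nat.cast_ne_zero.2 hw
  field_simp
  ring

lemma continuous_rootParam (w : ℕ) : Continuous (rootParam w) :=
  (continuous_const.sub Real.continuous_exp).rpow_const fun _ => Or.inr (by positivity)

lemma one_sub_mul_sub_sqrt_div {t : ℝ} (h0 : 0 ≤ t) (h1 : t < 1) :
    (1 - t) * (13 / 10 - √(t / (1 - t))) = bFun t := by
  have hp : 0 < 1 - t := by linarith
  have e : t * (1 - t) = t / (1 - t) * (1 - t) ^ 2 := by field_simp
  rw [bFun, e, Real.sqrt_mul (by positivity), Real.sqrt_sq hp.le]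
  ring

/-- The concavity statement, for every positive exponent `w`. -/
lemma concaveOn_comp_rootParam {w : ℕ} (hw : w ≠ 0) :
    ConcaveOn ℝ (Set.Icc (Real.log (1 - 2 ^ (-(w : ℤ)))) 0)
      (fun z => rootParam w z ^ w / (1 - rootParam w z ^ w) * bFun (rootParam w z)) := by
  have hw0 : (0 : ℝ) < w := by positivity
  have hint : ∀ z ∈ interior (Set.Icc (Real.log (1 - 2 ^ (-(w : ℤ)))) 0),
      z < 0 ∧ 0 < rootParam w z ∧ rootParam w z ≤ 1 / 2 := by
    intro z hz
    rw [interior_Icc] at hz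
    exact ⟨hz.2, rootParam_pos w hz.2, rootParam_le_half hw hz.1.le hz.2.le⟩
  refine concaveOn_of_hasDerivWithinAt2_nonpos (convex_Icc _ _)
    (f' := fun z => -(1 / w) * slopeFun w (rootParam w z))
    (f'' := fun z => -(1 / w) * (slopeFunDeriv w (rootParam w z) *
      -((1 - rootParam w z ^ w) * rootParam w z / (w * rootParam w z ^ w)))) ?_ ?_ ?_ ?_
  · have hc := continuous_rootParam w
    have hb : Continuous bFun := by unfold bFun; fun_prop
    refine ContinuousOn.mul (ContinuousOn.div (hc.pow w).continuousOn
      (continuous_const.sub (hc.pow w)).continuousOn ?_) (hb.comp hc).continuousOn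
    intro z hz
    rw [rootParam_pow hw hz.2]
    have := Real.exp_pos z
    linarith
  · intro z hz
    obtain ⟨hz0, ht0, ht1⟩ := hint z hz
    have hq : 0 < 1 - rootParam w z ^ w := sub_pos.2 (pow_lt_one₀ ht0.le (by linarith) hw)
    have h := (hasDerivAt_pow_div_mul_bFun hw ht0 (by linarith)).comp z
      (hasDerivAt_rootParam hw hz0)
    refine (h.congr_deriv ?_).hasDerivWithinAt
    field_simp
  · intro z hz
    obtain ⟨hz0, ht0, ht1⟩ := hint z hz
    exact (((hasDerivAt_slopeFun hw ht0 (by linarith)).comp z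
      (hasDerivAt_rootParam hw hz0)).const_mul _).hasDerivWithinAt
  · intro z hz
    obtain ⟨hz0, ht0, ht1⟩ := hint z hz
    have hq : 0 < 1 - rootParam w z ^ w := sub_pos.2 (pow_lt_one₀ ht0.le (by linarith) hw)
    have hpos : 0 ≤ 1 / w * ((1 - rootParam w z ^ w) * rootParam w z /
        (w * rootParam w z ^ w)) := by positivity
    have := mul_nonpos_of_nonneg_of_nonpos hpos (slopeFunDeriv_nonpos hw ht0 ht1)
    linarith

theorem stmt_11 (h : ℝ → ℝ)
    (hh : ∀ u : ℝ, h u = (1 - u) * (13 / 10 - Real.sqrt (u / (1 - u))))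
    (g : ℕ → ℝ → ℝ)
    (hg : ∀ (w : ℕ) (y : ℝ), g w y = ((1 - y) / y) * h ((1 - y) ^ ((1 : ℝ) / w)))
    (w : ℕ) (hw1 : 1 ≤ w) (hw5 : w ≤ 5) :
    ConcaveOn ℝ (Set.Icc (Real.log (1 - 2 ^ (-(w : ℤ)))) 0)
      (fun z : ℝ => g w (Real.exp z)) := by
  have hw : w ≠ 0 := by omega
  refine (concaveOn_comp_rootParam hw).congr fun z hz => ?_
  have ht0 := rootParam_nonneg w hz.2
  have ht1 := rootParam_le_half hw hz.1 hz.2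
  change rootParam w z ^ w / (1 - rootParam w z ^ w) * bFun (rootParam w z) = g w (Real.exp z)
  rw [hg, hh, ← rootParam, one_sub_mul_sub_sqrt_div ht0 (by linarith), rootParam_pow hw hz.2,
    sub_sub_cancel]
end

section
/- Let δ = 9789/10000 and h(t) = (1-t)·(13/10 - √(t/(1-t))) for t ∈ [0,1/2]. Then for all t₁, t₂ ∈ [0,1/2] the following four inequalities hold: (i) h(t₁) + δ⁻⁵·h(t₂) ≤ 2·(1069/1000)·h(√(t₁t₂)); (ii) 2·h(t₁) + 2·δ⁻⁵·(1069/1000)·h(t₂) ≤ 4·(1120/1000)·h(√(t₁t₂)); (iii) h(t₁) + δ⁻¹⁵·h(t₂) ≤ (5/2)·h(√(t₁t₂)); (iv) 2·δ⁻⁵·(1069/1000)·h(t₁) + (5/2)·h(t₂) ≤ 4·(1225/1000)·h(√(t₁t₂)). -/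
/-- The function `t ↦ (1 - t) * (13 / 10 - √(t / (1 - t)))` on `[0, 1 / 2]`, free of division. -/
noncomputable def profile (t : ℝ) : ℝ := 13 / 10 * (1 - t) - √t * √(1 - t)

theorem profile_nonneg {t : ℝ} (h0 : 0 ≤ t) (h1 : t ≤ 1 / 2) : 0 ≤ profile t := by
  have h2 : √t * √(1 - t) ≤ 1 / 2 := by
    nlinarith [sq_nonneg (√t - √(1 - t)), Real.sq_sqrt h0,
      Real.sq_sqrt (show 0 ≤ 1 - t by linarith)]
  unfold profile
  linarith

theorem profile_le_profile {t u : ℝ} (h0 : 0 ≤ t) (htu : t ≤ u) (hu : u ≤ 1 / 2) :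
    profile u ≤ profile t := by
  have h2 : √t * √(1 - t) ≤ √u * √(1 - u) := by
    rw [← Real.sqrt_mul h0, ← Real.sqrt_mul (h0.trans htu)]
    apply Real.sqrt_le_sqrt
    nlinarith
  unfold profile
  linarith

theorem mul_sub_sqrt_div_eq_profile {t : ℝ} (h1 : t ≤ 1 / 2) :
    (1 - t) * (13 / 10 - √(t / (1 - t))) = profile t := by
  have h2 : 0 < 1 - t := by linarith
  have h3 : √(1 - t) ≠ 0 := (Real.sqrt_pos.2 h2).ne'
  have h4 : (1 - t) * (√t / √(1 - t)) = √t * √(1 - t) := by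
    field_simp
    rw [Real.sq_sqrt h2.le, mul_comm]
  rw [Real.sqrt_div' _ h2.le, mul_sub, h4, profile]
  ring

/-- Bernstein criterion (degree `8`) for a quintic without quartic term. -/
theorem quintic_nonneg {c₀ c₁ c₂ c₃ c₅ Y y : ℝ} (hY : 0 < Y) (h0 : 0 ≤ y) (h1 : y ≤ Y)
    (hc : ∀ r : ℕ, r ≤ 8 → 0 ≤ c₀ + (r.choose 1 / 8 : ℝ) * (c₁ * Y)
      + (r.choose 2 / 28 : ℝ) * (c₂ * Y ^ 2) + (r.choose 3 / 56 : ℝ) * (c₃ * Y ^ 3)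
      + (r.choose 5 / 56 : ℝ) * (c₅ * Y ^ 5)) :
    0 ≤ c₀ + c₁ * y + c₂ * y ^ 2 + c₃ * y ^ 3 + c₅ * y ^ 5 := by
  obtain ⟨t, rfl⟩ : ∃ t, y = t * Y := ⟨y / Y, by field_simp⟩
  have ht0 : 0 ≤ t := nonneg_of_mul_nonneg_left h0 hY
  have ht1 : 0 ≤ 1 - t := by nlinarith
  have key : 0 ≤ ∑ r ∈ Finset.range 9, ((Nat.choose 8 r : ℝ) * (t ^ r * (1 - t) ^ (8 - r))) *
      (c₀ + (r.choose 1 / 8 : ℝ) * (c₁ * Y)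
      + (r.choose 2 / 28 : ℝ) * (c₂ * Y ^ 2) + (r.choose 3 / 56 : ℝ) * (c₃ * Y ^ 3)
      + (r.choose 5 / 56 : ℝ) * (c₅ * Y ^ 5)) := by
    refine Finset.sum_nonneg fun r hr => mul_nonneg (by positivity) (hc r ?_)
    have := Finset.mem_range.1 hr
    omega
  refine key.trans_eq ?_
  simp only [Finset.sum_range_succ, Finset.sum_range_zero, Nat.choose]
  push_cast
  ring

/-- Quadratic bounds for `√(1 - z)` reduce a two-point inequality for `profile` to the
nonnegativity of nine polynomials in one variable. -/
theorem profile_two_point {a b c p₀ p₁ p₂ u₀ u₁ u₂ : ℝ} (ha : 0 ≤ a) (hab : a ≤ b) (hc : 0 ≤ c)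
    (hp : ∀ z : ℝ, 0 ≤ z → z ≤ 1 / 2 → p₀ + p₁ * z + p₂ * z ^ 2 ≤ √(1 - z))
    (hu : ∀ z : ℝ, 0 ≤ z → z ≤ 1 / 2 → √(1 - z) ≤ u₀ + u₁ * z + u₂ * z ^ 2)
    (hq : ∀ k : ℝ, 0 ≤ k → k ≤ 1 → ∀ r : ℕ, r ≤ 8 → 0 ≤ 13 / 10 * (c - a - b)
      + (r.choose 1 / 8 : ℝ) * ((a * p₀ + b * p₀ * k ^ 2 - c * u₀ * k) * (442 / 625))
      + (r.choose 2 / 28 : ℝ) * (13 / 10 * (a + b * k ^ 4 - c * k ^ 2) * (442 / 625) ^ 2)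
      + (r.choose 3 / 56 : ℝ) * ((a * p₁ + b * p₁ * k ^ 6 - c * u₁ * k ^ 3) * (442 / 625) ^ 3)
      + (r.choose 5 / 56 : ℝ) * ((a * p₂ + b * p₂ * k ^ 10 - c * u₂ * k ^ 5) * (442 / 625) ^ 5))
    {t₁ t₂ : ℝ} (ht₁ : t₁ ∈ Set.Icc (0 : ℝ) (1 / 2)) (ht₂ : t₂ ∈ Set.Icc (0 : ℝ) (1 / 2)) :
    a * profile t₁ + b * profile t₂ ≤ c * profile √(t₁ * t₂) := by
  wlog h21 : t₂ ≤ t₁ generalizing t₁ t₂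
  · have h12 := le_of_not_ge h21
    have h3 := this ht₂ ht₁ h12
    rw [mul_comm t₂] at h3
    nlinarith [profile_le_profile ht₁.1 h12 ht₂.2]
  obtain ⟨y, k, hy0, hk0, hk1, rfl, rfl⟩ :
      ∃ y k : ℝ, 0 ≤ y ∧ 0 ≤ k ∧ k ≤ 1 ∧ t₁ = y ^ 2 ∧ t₂ = (y * k ^ 2) ^ 2 := by
    have h0 : 0 ≤ t₂ / t₁ := div_nonneg ht₂.1 ht₁.1
    refine ⟨√t₁, √√(t₂ / t₁), by positivity, by positivity, ?_, (Real.sq_sqrt ht₁.1).symm, ?_⟩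
    · exact Real.sqrt_le_one.2 (Real.sqrt_le_one.2 (div_le_one_of_le₀ h21 ht₁.1))
    · rw [Real.sq_sqrt (Real.sqrt_nonneg _), mul_pow, Real.sq_sqrt h0, Real.sq_sqrt ht₁.1]
      rcases ht₁.1.eq_or_lt with h | h
      · rw [← h, zero_mul]
        linarith [ht₂.1]
      · field_simp
  have hy2 : y ^ 2 ≤ 1 / 2 := ht₁.2
  have hgm : √(y ^ 2 * (y * k ^ 2) ^ 2) = (y * k) ^ 2 := by
    rw [show y ^ 2 * (y * k ^ 2) ^ 2 = ((y * k) ^ 2) ^ 2 by ring]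
    exact Real.sqrt_sq (by positivity)
  have hyk : (y * k) ^ 2 ≤ 1 / 2 := by
    rw [mul_pow]
    exact (mul_le_of_le_one_right (by positivity) (pow_le_one₀ hk0 hk1)).trans hy2
  have hb : 0 ≤ b := ha.trans hab
  have e₁ := mul_le_mul_of_nonneg_left (hp _ ht₁.1 ht₁.2) (mul_nonneg ha hy0)
  have e₂ := mul_le_mul_of_nonneg_left (hp _ ht₂.1 ht₂.2)
    (show 0 ≤ b * (y * k ^ 2) by positivity)
  have e₃ := mul_le_mul_of_nonneg_left (hu _ (sq_nonneg _) hyk)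
    (show 0 ≤ c * (y * k) by positivity)
  have key := quintic_nonneg (Y := 442 / 625) (by norm_num) hy0 (by nlinarith) (hq k hk0 hk1)
  rw [hgm]
  simp only [profile]
  rw [Real.sqrt_sq hy0, Real.sqrt_sq (show 0 ≤ y * k ^ 2 by positivity),
    Real.sqrt_sq (show 0 ≤ y * k by positivity)]
  linarith

/-- Bernstein basis polynomials on `[p, q]` are nonnegative there. -/
theorem bernstein_basis_nonneg {p q k : ℝ} (h0 : p ≤ k) (h1 : k ≤ q) (i j : ℕ) :
    0 ≤ (k - p) ^ i * (q - k) ^ j :=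
  mul_nonneg (pow_nonneg (sub_nonneg.2 h0) _) (pow_nonneg (sub_nonneg.2 h1) _)

set_option maxHeartbeats 1000000 in
theorem profile_two_point_of_1069 {t₁ t₂ : ℝ} (ht₁ : t₁ ∈ Set.Icc (0 : ℝ) (1 / 2))
    (ht₂ : t₂ ∈ Set.Icc (0 : ℝ) (1 / 2)) :
    1 * profile t₁ + 1112522 / 1000000 * profile t₂ ≤ 2138 / 1000 * profile √(t₁ * t₂) := by
  refine profile_two_point (p₀ := 614 / 625) (p₁ := -1979 / 5000) (p₂ := -1549 / 5000)
    (u₀ := 1) (u₁ := -237 / 500) (u₂ := -1113 / 5000)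
    (by norm_num) (by norm_num) (by norm_num) ?_ ?_ ?_ ht₁ ht₂
  · intro z h0 h1
    apply Real.le_sqrt_of_sq_le
    have h2 : 0 ≤ 1 / 2 - z := by linarith
    nlinarith [mul_nonneg h2 (sq_nonneg (z - 43 / 100)),
      mul_nonneg (mul_nonneg h2 h0) (sq_nonneg (z - 43 / 100))]
  · intro z h0 h1
    apply Real.sqrt_le_iff.2 ⟨by nlinarith, ?_⟩
    have h2 : 0 ≤ 1 / 2 - z := by linarith
    nlinarith [mul_nonneg h0 (sq_nonneg (z - 451 / 1000)),
      mul_nonneg (mul_nonneg h2 h0) (sq_nonneg (z - 451 / 1000))]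
  · intro k hk0 hk1 r hr
    rcases le_total k (19 / 20) with h1 | h1
    · have hb := bernstein_basis_nonneg hk0 h1
      interval_cases r <;> norm_num [Nat.choose] <;>
        linarith [hb 0 10, hb 1 9, hb 2 8, hb 3 7, hb 4 6, hb 5 5, hb 6 4, hb 7 3, hb 8 2, hb 9 1,
          hb 10 0]
    · have hb := bernstein_basis_nonneg h1 hk1
      interval_cases r <;> norm_num [Nat.choose] <;>
        linarith [hb 0 10, hb 1 9, hb 2 8, hb 3 7, hb 4 6, hb 5 5, hb 6 4, hb 7 3, hb 8 2, hb 9 1,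
          hb 10 0]

set_option maxHeartbeats 1000000 in
theorem profile_two_point_of_1120 {t₁ t₂ : ℝ} (ht₁ : t₁ ∈ Set.Icc (0 : ℝ) (1 / 2))
    (ht₂ : t₂ ∈ Set.Icc (0 : ℝ) (1 / 2)) :
    2 * profile t₁ + 2378573 / 1000000 * profile t₂ ≤ 448 / 100 * profile √(t₁ * t₂) := by
  refine profile_two_point (p₀ := 9857 / 10000) (p₁ := -4103 / 10000) (p₂ := -147 / 500)
    (u₀ := 1) (u₁ := -4773 / 10000) (u₂ := -43 / 200)
    (by norm_num) (by norm_num) (by norm_num) ?_ ?_ ?_ ht₁ ht₂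
  · intro z h0 h1
    apply Real.le_sqrt_of_sq_le
    have h2 : 0 ≤ 1 / 2 - z := by linarith
    nlinarith [mul_nonneg h2 (sq_nonneg (z - 2 / 5)),
      mul_nonneg (mul_nonneg h2 h0) (sq_nonneg (z - 2 / 5))]
  · intro z h0 h1
    apply Real.sqrt_le_iff.2 ⟨by nlinarith, ?_⟩
    have h2 : 0 ≤ 1 / 2 - z := by linarith
    nlinarith [mul_nonneg h0 (sq_nonneg (z - 43 / 100)),
      mul_nonneg (mul_nonneg h2 h0) (sq_nonneg (z - 43 / 100))]
  · intro k hk0 hk1 r hr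
    rcases le_total k (93 / 100) with h1 | h1
    · have hb := bernstein_basis_nonneg hk0 h1
      interval_cases r <;> norm_num [Nat.choose] <;>
        linarith [hb 0 10, hb 1 9, hb 2 8, hb 3 7, hb 4 6, hb 5 5, hb 6 4, hb 7 3, hb 8 2, hb 9 1,
          hb 10 0]
    · have hb := bernstein_basis_nonneg h1 hk1
      interval_cases r <;> norm_num [Nat.choose] <;>
        linarith [hb 0 10, hb 1 9, hb 2 8, hb 3 7, hb 4 6, hb 5 5, hb 6 4, hb 7 3, hb 8 2, hb 9 1,
          hb 10 0]

set_option maxHeartbeats 1000000 in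
theorem profile_two_point_of_five_halves {t₁ t₂ : ℝ} (ht₁ : t₁ ∈ Set.Icc (0 : ℝ) (1 / 2))
    (ht₂ : t₂ ∈ Set.Icc (0 : ℝ) (1 / 2)) :
    1 * profile t₁ + 1376973 / 1000000 * profile t₂ ≤ 5 / 2 * profile √(t₁ * t₂) := by
  refine profile_two_point (p₀ := 24691 / 25000) (p₁ := -41893 / 100000) (p₂ := -2843 / 10000)
    (u₀ := 1) (u₁ := -48047 / 100000) (u₂ := -5189 / 25000)
    (by norm_num) (by norm_num) (by norm_num) ?_ ?_ ?_ ht₁ ht₂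
  · intro z h0 h1
    apply Real.le_sqrt_of_sq_le
    have h2 : 0 ≤ 1 / 2 - z := by linarith
    nlinarith [mul_nonneg h2 (sq_nonneg (z - 19 / 50)),
      mul_nonneg (mul_nonneg h2 h0) (sq_nonneg (z - 19 / 50))]
  · intro z h0 h1
    apply Real.sqrt_le_iff.2 ⟨by nlinarith, ?_⟩
    have h2 : 0 ≤ 1 / 2 - z := by linarith
    nlinarith [mul_nonneg h0 (sq_nonneg (z - 51 / 125)),
      mul_nonneg (mul_nonneg h2 h0) (sq_nonneg (z - 51 / 125))]
  · intro k hk0 hk1 r hr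
    rcases le_total k (9 / 10) with h1 | h1
    · have hb := bernstein_basis_nonneg hk0 h1
      interval_cases r <;> norm_num [Nat.choose] <;>
        linarith [hb 0 10, hb 1 9, hb 2 8, hb 3 7, hb 4 6, hb 5 5, hb 6 4, hb 7 3, hb 8 2, hb 9 1,
          hb 10 0]
    · rcases le_total k (19 / 20) with h2 | h2
      · have hb := bernstein_basis_nonneg h1 h2
        interval_cases r <;> norm_num [Nat.choose] <;>
          linarith [hb 0 10, hb 1 9, hb 2 8, hb 3 7, hb 4 6, hb 5 5, hb 6 4, hb 7 3, hb 8 2, hb 9 1,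
            hb 10 0]
      · have hb := bernstein_basis_nonneg h2 hk1
        interval_cases r <;> norm_num [Nat.choose] <;>
          linarith [hb 0 10, hb 1 9, hb 2 8, hb 3 7, hb 4 6, hb 5 5, hb 6 4, hb 7 3, hb 8 2, hb 9 1,
            hb 10 0]

set_option maxHeartbeats 1000000 in
theorem profile_two_point_of_1225 {t₁ t₂ : ℝ} (ht₁ : t₁ ∈ Set.Icc (0 : ℝ) (1 / 2))
    (ht₂ : t₂ ∈ Set.Icc (0 : ℝ) (1 / 2)) :
    2378573 / 1000000 * profile t₁ + 5 / 2 * profile t₂ ≤ 49 / 10 * profile √(t₁ * t₂) := by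
  refine profile_two_point (p₀ := 3943 / 4000) (p₁ := -10257 / 25000) (p₂ := -14701 / 50000)
    (u₀ := 1) (u₁ := -47579 / 100000) (u₂ := -21859 / 100000)
    (by norm_num) (by norm_num) (by norm_num) ?_ ?_ ?_ ht₁ ht₂
  · intro z h0 h1
    apply Real.le_sqrt_of_sq_le
    have h2 : 0 ≤ 1 / 2 - z := by linarith
    nlinarith [mul_nonneg h2 (sq_nonneg (z - 2 / 5)),
      mul_nonneg (mul_nonneg h2 h0) (sq_nonneg (z - 2 / 5))]
  · intro z h0 h1
    apply Real.sqrt_le_iff.2 ⟨by nlinarith, ?_⟩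
    have h2 : 0 ≤ 1 / 2 - z := by linarith
    nlinarith [mul_nonneg h0 (sq_nonneg (z - 11 / 25)),
      mul_nonneg (mul_nonneg h2 h0) (sq_nonneg (z - 11 / 25))]
  · intro k hk0 hk1 r hr
    rcases le_total k (97 / 100) with h1 | h1
    · have hb := bernstein_basis_nonneg hk0 h1
      interval_cases r <;> norm_num [Nat.choose] <;>
        linarith [hb 0 10, hb 1 9, hb 2 8, hb 3 7, hb 4 6, hb 5 5, hb 6 4, hb 7 3, hb 8 2, hb 9 1,
          hb 10 0]
    · have hb := bernstein_basis_nonneg h1 hk1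
      interval_cases r <;> norm_num [Nat.choose] <;>
        linarith [hb 0 10, hb 1 9, hb 2 8, hb 3 7, hb 4 6, hb 5 5, hb 6 4, hb 7 3, hb 8 2, hb 9 1,
          hb 10 0]

theorem stmt_12 (δ : ℝ) (hδ : δ = 9789 / 10000)
    (h : ℝ → ℝ) (hh : ∀ u : ℝ, h u = (1 - u) * (13 / 10 - Real.sqrt (u / (1 - u))))
    (t₁ t₂ : ℝ) (ht₁ : t₁ ∈ Set.Icc (0 : ℝ) (1 / 2)) (ht₂ : t₂ ∈ Set.Icc (0 : ℝ) (1 / 2)) :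
    h t₁ + δ ^ (-(5 : ℤ)) * h t₂ ≤ 2 * (1069 / 1000) * h (Real.sqrt (t₁ * t₂)) ∧
    2 * h t₁ + 2 * δ ^ (-(5 : ℤ)) * (1069 / 1000) * h t₂ ≤
      4 * (1120 / 1000) * h (Real.sqrt (t₁ * t₂)) ∧
    h t₁ + δ ^ (-(15 : ℤ)) * h t₂ ≤ (5 / 2) * h (Real.sqrt (t₁ * t₂)) ∧
    2 * δ ^ (-(5 : ℤ)) * (1069 / 1000) * h t₁ + (5 / 2) * h t₂ ≤
      4 * (1225 / 1000) * h (Real.sqrt (t₁ * t₂)) := by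
  have hprof : ∀ t ∈ Set.Icc (0 : ℝ) (1 / 2), h t = profile t := fun t ht =>
    (hh t).trans (mul_sub_sqrt_div_eq_profile ht.2)
  have hgm : √(t₁ * t₂) ∈ Set.Icc (0 : ℝ) (1 / 2) :=
    ⟨Real.sqrt_nonneg _, Real.sqrt_le_iff.2
      ⟨by norm_num, by nlinarith [ht₁.1, ht₁.2, ht₂.1, ht₂.2]⟩⟩
  have h5 : δ ^ (-(5 : ℤ)) ≤ 1112522 / 1000000 := by
    subst hδ
    norm_num
  have h15 : δ ^ (-(15 : ℤ)) ≤ 1376973 / 1000000 := by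
    subst hδ
    norm_num
  rw [hprof _ ht₁, hprof _ ht₂, hprof _ hgm]
  have n₁ := profile_nonneg ht₁.1 ht₁.2
  have n₂ := profile_nonneg ht₂.1 ht₂.2
  have b₁ := mul_le_mul_of_nonneg_right h5 n₁
  have b₂ := mul_le_mul_of_nonneg_right h5 n₂
  have b₃ := mul_le_mul_of_nonneg_right h15 n₂
  have i₁ := profile_two_point_of_1069 ht₁ ht₂
  have i₂ := profile_two_point_of_1120 ht₁ ht₂
  have i₃ := profile_two_point_of_five_halves ht₁ ht₂
  have i₄ := profile_two_point_of_1225 ht₁ ht₂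
  refine ⟨?_, ?_, ?_, ?_⟩ <;> linarith
end

section
/- Let δ = 9789/10000, ψ = 13/10, K₂ = 1069/1000, and let C⁽⁰⁾ = 0, C⁽¹⁾ = 1, C⁽²⁾ = 102/100, C⁽³⁾ = 103/100, C⁽⁴⁾ = 104/100, C⁽⁵⁾ = 105/100. Define the constants τ_{0,0} = 0; τ_{0,1} = τ_{1,0} = 42/100; τ_{0,2} = 54/100, τ_{1,1} = 59/100, τ_{2,0} = 63/100; τ_{0,3} = 72/100, τ_{1,2} = 74/100, τ_{2,1} = 76/100, τ_{3,0} = 79/100; τ_{0,4} = 864/1000, τ_{1,3} = 868/1000, τ_{2,2} = 876/1000, τ_{3,1} = 886/1000, τ_{4,0} = 901/1000; and τ_{b₂,b₃} = 1 - 10⁻⁴ whenever b₂+b₃ = 5. Then for all non-negative integers b₂, b₃ with b₂ + b₃ ≤ 5 and all v₁, v₂ ∈ [0, 1/2], it holds that δ^{b₂} · ( 2·b₃·K₂·C⁽ᵇ³⁾·(v₂²/(1+v₂))·(ψ - √(v₂/(1-v₂))) + b₂·v₁·(ψ - √(v₁/(1-v₁))) ) / ( ψ - (1-v₁)^{b₂/2}·(1-v₂²)^{b₃/2}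 ) ≤ τ_{b₂,b₃}. -/
noncomputable def stmt15C : ℕ → ℝ
  | 0 => 0
  | 1 => 1
  | 2 => 102 / 100
  | 3 => 103 / 100
  | 4 => 104 / 100
  | 5 => 105 / 100
  | _ => 0

noncomputable def stmt15tau : ℕ → ℕ → ℝ
  | 0, 0 => 0
  | 0, 1 => 42 / 100
  | 1, 0 => 42 / 100
  | 0, 2 => 54 / 100
  | 1, 1 => 59 / 100
  | 2, 0 => 63 / 100
  | 0, 3 => 72 / 100
  | 1, 2 => 74 / 100
  | 2, 1 => 76 / 100
  | 3, 0 => 79 / 100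
  | 0, 4 => 864 / 1000
  | 1, 3 => 868 / 1000
  | 2, 2 => 876 / 1000
  | 3, 1 => 886 / 1000
  | 4, 0 => 901 / 1000
  | _, _ => 1 - 1 / 10 ^ 4

/-- The tangent-plane bound at `(x ^ 2, y ^ 2)` for the concave function
`(p ^ k, q ^ k) ↦ p ^ (m / 2) * q ^ (n / 2)`, where `m + n ≤ 2 * k`. -/
lemma rpow_mul_rpow_le_tangent {m n k : ℕ} (hk : 0 < k) (hmn : m + n ≤ 2 * k) {p q x y : ℝ}
    (hp : 0 ≤ p) (hq : 0 ≤ q) (hx : 0 < x) (hy : 0 < y) :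
    p ^ ((m : ℝ) / 2) * q ^ ((n : ℝ) / 2) ≤
      x ^ m * y ^ n * (1 + m / (2 * k) * ((p / x ^ 2) ^ k - 1) +
        n / (2 * k) * ((q / y ^ 2) ^ k - 1)) := by
  have hk' : (0 : ℝ) < k := by exact_mod_cast hk
  have hmn' : (m : ℝ) + n ≤ 2 * k := by exact_mod_cast hmn
  have key : ∀ (j : ℕ) {r z : ℝ}, 0 ≤ r → 0 < z →
      r ^ ((j : ℝ) / 2) = z ^ j * ((r / z ^ 2) ^ k) ^ ((j : ℝ) / (2 * k)) := by
    intro j r z hr hz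
    have hz2 : 0 < z ^ 2 := by positivity
    have hzj : z ^ j = (z ^ 2) ^ ((j : ℝ) / 2) := by
      rw [← Real.rpow_natCast z 2, ← Real.rpow_mul hz.le, ← Real.rpow_natCast]
      congr 1
      push_cast
      ring
    rw [← Real.rpow_natCast (r / z ^ 2) k, ← Real.rpow_mul (by positivity), hzj,
      show (k : ℝ) * (j / (2 * k)) = j / 2 by field_simp,
      ← Real.mul_rpow hz2.le (by positivity), mul_div_cancel₀ _ hz2.ne']
  have hw : 0 ≤ 1 - (m : ℝ) / (2 * k) - n / (2 * k) := by
    rw [sub_sub, ← add_div, sub_nonneg, div_le_one (by positivity)]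
    exact hmn'
  have amgm := Real.geom_mean_le_arith_mean3_weighted
    (by positivity : 0 ≤ (m : ℝ) / (2 * k)) (by positivity : 0 ≤ (n : ℝ) / (2 * k)) hw
    (by positivity : 0 ≤ (p / x ^ 2) ^ k) (by positivity : 0 ≤ (q / y ^ 2) ^ k)
    zero_le_one (by ring)
  rw [Real.one_rpow, mul_one] at amgm
  rw [key m hp hx, key n hq hy, mul_mul_mul_comm]
  exact mul_le_mul_of_nonneg_left (by linarith) (by positivity)

/-- On `[0, 1/2]`, `s = √(v / (1 - v))` lies in `[0, 1]` and `v = s ^ 2 / (1 + s ^ 2)`. -/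
lemma sqrt_odds_mem_and_eq {v : ℝ} (hv : v ∈ Set.Icc (0 : ℝ) (1 / 2)) :
    √(v / (1 - v)) ∈ Set.Icc (0 : ℝ) 1 ∧
      v = √(v / (1 - v)) ^ 2 / (1 + √(v / (1 - v)) ^ 2) := by
  obtain ⟨h0, h1⟩ := hv
  have h2 : 0 < 1 - v := by linarith
  refine ⟨⟨Real.sqrt_nonneg _, Real.sqrt_le_one.mpr ((div_le_one h2).mpr (by linarith))⟩, ?_⟩
  rw [Real.sq_sqrt (by positivity)]
  field_simp
  ring

lemma mul_sub_sqrt_odds_le {v : ℝ} (hv : v ∈ Set.Icc (0 : ℝ) (1 / 2)) :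
    v * (13 / 10 - √(v / (1 - v))) ≤
      173298 / 1000000 + 39857 / 100000 * (v - 23 / 100) - 1466 / 1000 * (v - 23 / 100) ^ 2 := by
  obtain ⟨⟨h0, h1⟩, hs⟩ := sqrt_odds_mem_and_eq hv
  generalize √(v / (1 - v)) = s at h0 h1 hs
  subst hs
  rw [← sub_nonneg]
  have bern (i j : ℕ) : 0 ≤ (s - 5465 / 10000) ^ 2 * (s ^ i * (1 - s) ^ j) := by
    have := sub_nonneg.mpr h1
    positivity
  have key : 0 ≤ (173298 / 1000000 - 39857 / 100000 * (23 / 100) - 1466 / 1000 * (23 / 100) ^ 2)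
      * (1 + s ^ 2) ^ 2 + (39857 / 100000 + 1466 / 1000 * (46 / 100)) * (s ^ 2 * (1 + s ^ 2))
      - 1466 / 1000 * s ^ 4 - s ^ 2 * (1 + s ^ 2) * (13 / 10 - s) := by
    linarith [bern 0 0, bern 1 0, bern 0 3,
      mul_nonneg (bern 1 0) (sq_nonneg (s - 35 / 100)),
      mul_nonneg (bern 0 1) (sq_nonneg (s - 35 / 100))]
  refine (div_nonneg key (by positivity : 0 ≤ (1 + s ^ 2) ^ 2)).trans_eq ?_
  field_simp
  ring

lemma sq_div_mul_sub_sqrt_odds_le {v : ℝ} (hv : v ∈ Set.Icc (0 : ℝ) (1 / 2)) :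
    v ^ 2 / (1 + v) * (13 / 10 - √(v / (1 - v))) ≤
      50815 / 1000000 + 1663 / 10000 * (v ^ 2 - 119 / 1000)
        - 131 / 100 * (v ^ 2 - 119 / 1000) ^ 2 := by
  obtain ⟨⟨h0, h1⟩, hs⟩ := sqrt_odds_mem_and_eq hv
  generalize √(v / (1 - v)) = s at h0 h1 hs
  subst hs
  rw [← sub_nonneg]
  have bern (i j : ℕ) : 0 ≤ (s - 7257 / 10000) ^ 2 * (s ^ i * (1 - s) ^ j) := by
    have := sub_nonneg.mpr h1
    positivity
  have key : 0 ≤ (1 + 2 * s ^ 2) *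
      ((50815 / 1000000 - 1663 / 10000 * (119 / 1000) - 131 / 100 * (119 / 1000) ^ 2)
        * (1 + s ^ 2) ^ 4
      + (1663 / 10000 + 131 / 100 * (238 / 1000)) * (s ^ 4 * (1 + s ^ 2) ^ 2)
      - 131 / 100 * s ^ 8) - s ^ 4 * (1 + s ^ 2) ^ 3 * (13 / 10 - s) := by
    linarith [bern 0 9, bern 1 8, bern 2 7, bern 3 6, bern 4 5, bern 5 4, bern 6 3, bern 7 2,
      bern 8 1, bern 9 0]
  have hd : 1 + s ^ 2 / (1 + s ^ 2) = (1 + 2 * s ^ 2) / (1 + s ^ 2) := by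
    field_simp
    ring
  rw [hd]
  refine (div_nonneg key (by positivity : 0 ≤ (1 + 2 * s ^ 2) * (1 + s ^ 2) ^ 4)).trans_eq ?_
  field_simp
  ring

lemma quadratic_bound_le_tau {m n : ℕ} (hmn : m + n ≤ 5) {v w : ℝ}
    (hv : v ∈ Set.Icc (0 : ℝ) (1 / 2)) (hw : w ∈ Set.Icc (0 : ℝ) (1 / 4)) :
    (9789 / 10000) ^ m *
        (2 * n * (1069 / 1000) * stmt15C n * (50815 / 1000000 + 1663 / 10000 * (w - 119 / 1000)
            - 131 / 100 * (w - 119 / 1000) ^ 2) +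
          m * (173298 / 1000000 + 39857 / 100000 * (v - 23 / 100)
            - 1466 / 1000 * (v - 23 / 100) ^ 2)) ≤
      stmt15tau m n * (13 / 10 - (22 / 25) ^ m * (47 / 50) ^ n *
        (1 + m / (2 * ((m + n - 1) / 2 + 1 : ℕ)) *
            (((1 - v) / (22 / 25) ^ 2) ^ ((m + n - 1) / 2 + 1) - 1) +
          n / (2 * ((m + n - 1) / 2 + 1 : ℕ)) *
            (((1 - w) / (47 / 50) ^ 2) ^ ((m + n - 1) / 2 + 1) - 1))) := by
  obtain ⟨hv0, hv1⟩ := hv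
  obtain ⟨hw0, hw1⟩ := hw
  have hm : m ≤ 5 := by omega
  have hn : n ≤ 5 := by omega
  have hv2 : 0 ≤ v * (v - 242 / 1000) ^ 2 := mul_nonneg hv0 (sq_nonneg _)
  have hw2 : 0 ≤ w * (w - 111 / 1000) ^ 2 := mul_nonneg hw0 (sq_nonneg _)
  interval_cases m <;> interval_cases n <;> try omega
  all_goals norm_num [stmt15C, stmt15tau]
  all_goals
    linarith [sq_nonneg (v - 200 / 1000), sq_nonneg (v - 223 / 1000), sq_nonneg (v - 229 / 1000),
      sq_nonneg (v - 234 / 1000), sq_nonneg (v - 240 / 1000), sq_nonneg (v - 255 / 1000),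
      sq_nonneg (v - 280 / 1000), sq_nonneg (w - 111 / 1000), sq_nonneg (w - 117 / 1000), sq_nonneg (w - 119 / 1000),
      sq_nonneg (w - 121 / 1000), sq_nonneg (w - 125 / 1000), sq_nonneg (w - 135 / 1000)]

theorem stmt_15 (δ ψ K₂ : ℝ) (hδ : δ = 9789 / 10000) (hψ : ψ = 13 / 10)
    (hK : K₂ = 1069 / 1000)
    (b₂ b₃ : ℕ) (hb : b₂ + b₃ ≤ 5)
    (v₁ v₂ : ℝ) (hv₁ : v₁ ∈ Set.Icc (0 : ℝ) (1 / 2)) (hv₂ : v₂ ∈ Set.Icc (0 : ℝ) (1 / 2)) :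
    δ ^ b₂ *
        (2 * b₃ * K₂ * stmt15C b₃ * (v₂ ^ 2 / (1 + v₂)) * (ψ - Real.sqrt (v₂ / (1 - v₂))) +
          b₂ * v₁ * (ψ - Real.sqrt (v₁ / (1 - v₁)))) /
      (ψ - (1 - v₁) ^ ((b₂ : ℝ) / 2) * (1 - v₂ ^ 2) ^ ((b₃ : ℝ) / 2)) ≤
    stmt15tau b₂ b₃ := by
  subst hδ hψ hK
  have hw : v₂ ^ 2 ∈ Set.Icc (0 : ℝ) (1 / 4) := ⟨sq_nonneg _, by nlinarith [hv₂.1, hv₂.2]⟩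
  have hp : (0 : ℝ) ≤ 1 - v₁ := by linarith [hv₁.2]
  have hq : 0 ≤ 1 - v₂ ^ 2 := by linarith [hw.2]
  have hp1 : (1 - v₁) ^ ((b₂ : ℝ) / 2) ≤ 1 :=
    Real.rpow_le_one hp (by linarith [hv₁.1]) (by positivity)
  have hq1 : (1 - v₂ ^ 2) ^ ((b₃ : ℝ) / 2) ≤ 1 :=
    Real.rpow_le_one hq (by linarith [hw.1]) (by positivity)
  have hden := mul_le_one₀ hp1 (Real.rpow_nonneg hq _) hq1
  rw [div_le_iff₀ (by linarith)]
  have hC : 0 ≤ stmt15C b₃ := by unfold stmt15C; split <;> norm_num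
  have htau : 0 ≤ stmt15tau b₂ b₃ := by unfold stmt15tau; split <;> norm_num
  have hnum := mul_sub_sqrt_odds_le hv₁
  have hnum' := sq_div_mul_sub_sqrt_odds_le hv₂
  have htan := rpow_mul_rpow_le_tangent (m := b₂) (n := b₃) (k := (b₂ + b₃ - 1) / 2 + 1)
    (by omega) (by omega) hp hq (by norm_num : (0 : ℝ) < 22 / 25) (by norm_num : (0 : ℝ) < 47 / 50)
  refine le_trans ?_ ((quadratic_bound_le_tau hb hv₁ hw).trans
    (mul_le_mul_of_nonneg_left (sub_le_sub_left htan _) htau))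
  rw [mul_assoc _ (v₂ ^ 2 / (1 + v₂)), mul_assoc _ v₁]
  gcongr
end

section
/- Let k ≥ 2 and Δ ≥ 2 be integers and define f(z) = (1-z^{k-1})^{Δ-1} / (1 + (1-z^{k-1})^{Δ-1}) for z ∈ [0,1]. Then: (a) f is strictly decreasing on [0,1]; (b) there is a unique x ∈ [0,1] with f(x) = x, and this x satisfies 0 < x < 1; (c) at this fixed point, |f'(x)| = (Δ-1)(k-1)·x^{k-1}·(1-x)/(1-x^{k-1}); and (d) if |f'(x)| < 1, then z = x is the unique solution in [0,1] of the equation f(f(z)) = z. -/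
/-- Three-point form of the fact that power maps have nonpositive Schwarzian derivative. -/
theorem pow_sub_mul_pow_sub_le {a x b : ℝ} (ha : 0 ≤ a) (hax : a ≤ x) (hxb : x ≤ b) (n : ℕ) :
    (x ^ n - a ^ n) * (b ^ n - x ^ n) * (b - a) ≤
      n * x ^ (n - 1) * (b ^ n - a ^ n) * ((x - a) * (b - x)) := by
  have hx : 0 ≤ x := ha.trans hax
  have mono {p q : ℝ} (hp : 0 ≤ p) (hpq : p ≤ q) {i j : ℕ} (hij : i ≤ j) (hj : j < n) :
      q ^ i * p ^ (n - 1 - i) ≤ q ^ j * p ^ (n - 1 - j) := by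
    obtain ⟨c, rfl⟩ := Nat.exists_eq_add_of_le hij
    have e : n - 1 - i = c + (n - 1 - (i + c)) := by omega
    rw [e, pow_add, pow_add, mul_assoc]
    have := hp.trans hpq
    gcongr
  have key : (∑ i ∈ Finset.range n, x ^ i * a ^ (n - 1 - i)) *
      (∑ i ∈ Finset.range n, b ^ i * x ^ (n - 1 - i)) ≤
      n * ∑ i ∈ Finset.range n,
        (x ^ i * a ^ (n - 1 - i)) * (b ^ i * x ^ (n - 1 - i)) := by
    have hmono : MonovaryOn (fun i => x ^ i * a ^ (n - 1 - i))
        (fun i => b ^ i * x ^ (n - 1 - i)) (Finset.range n : Set ℕ) := by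
      refine MonotoneOn.monovaryOn (fun i _ j hj hij => ?_) (fun i _ j hj hij => ?_)
      · exact mono ha hax hij (by simpa using hj)
      · exact mono hx hxb hij (by simpa using hj)
    simpa using hmono.sum_mul_sum_le_card_mul_sum
  have hprod : ∑ i ∈ Finset.range n, (x ^ i * a ^ (n - 1 - i)) * (b ^ i * x ^ (n - 1 - i)) =
      x ^ (n - 1) * ∑ i ∈ Finset.range n, b ^ i * a ^ (n - 1 - i) := by
    rw [Finset.mul_sum]
    refine Finset.sum_congr rfl fun i hi => ?_
    have e : n - 1 = i + (n - 1 - i) := by have := Finset.mem_range.mp hi; omega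
    conv_rhs => rw [e, pow_add, ← e]
    ring
  rw [hprod] at key
  rw [← (Commute.all x a).geom_sum₂_mul n, ← (Commute.all b x).geom_sum₂_mul n,
    ← (Commute.all b a).geom_sum₂_mul n]
  have hw : 0 ≤ (x - a) * (b - x) * (b - a) :=
    mul_nonneg (mul_nonneg (by linarith) (by linarith)) (by linarith)
  nlinarith [mul_le_mul_of_nonneg_right key hw]

/-- If `z ↦ h z / (1 + h z)` with `h z = (1 - z ^ m) ^ d` fixes `x` and swaps `p < x < q`, then its
derivative at `x` is at least one in absolute value. -/
theorem one_le_of_two_cycle {m d : ℕ} {p x q : ℝ} (hp : 0 ≤ p) (hpx : p < x) (hxq : x < q)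
    (hq : q < 1) (hm : m ≠ 0)
    (hfx : (1 - x ^ m) ^ d = x / (1 - x)) (hfp : (1 - p ^ m) ^ d = q / (1 - q))
    (hfq : (1 - q ^ m) ^ d = p / (1 - p)) :
    1 ≤ (d * (1 - x ^ m) ^ (d - 1)) * (m * x ^ (m - 1)) * (1 - x) ^ 2 := by
  have hx : 0 < x := hp.trans_lt hpx
  have hpxm : p ^ m < x ^ m := pow_lt_pow_left₀ hpx hp hm
  have hxqm : x ^ m < q ^ m := pow_lt_pow_left₀ hxq hx.le hm
  have hqm : q ^ m < 1 := pow_lt_one₀ (hx.trans hxq).le hq hm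
  have hinner := pow_sub_mul_pow_sub_le hp hpx.le hxq.le m
  have houter := pow_sub_mul_pow_sub_le (a := 1 - q ^ m) (x := 1 - x ^ m) (b := 1 - p ^ m)
    (by linarith) (by linarith) (by linarith) d
  rw [hfx, hfp, hfq] at houter
  have h1p : 0 < 1 - p := by linarith
  have h1x : 0 < 1 - x := by linarith
  have h1q : 0 < 1 - q := by linarith
  have eqp : q / (1 - q) - p / (1 - p) = (q - p) / ((1 - q) * (1 - p)) := by field_simp; ring
  have exp : x / (1 - x) - p / (1 - p) = (x - p) / ((1 - x) * (1 - p)) := by field_simp; ring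
  have eqx : q / (1 - q) - x / (1 - x) = (q - x) / ((1 - q) * (1 - x)) := by field_simp; ring
  rw [eqp, exp, eqx] at houter
  set A := (d : ℝ) * (1 - x ^ m) ^ (d - 1)
  set B := (m : ℝ) * x ^ (m - 1)
  have hA0 : 0 ≤ A := mul_nonneg d.cast_nonneg (pow_nonneg (by linarith) _)
  have hr : 0 < q ^ m - p ^ m := by linarith
  have hs : 0 < (q - p) * (x - p) * (q - x) :=
    mul_pos (mul_pos (by linarith) (by linarith)) (by linarith)
  have houter' : (x - p) * (q - x) * (q ^ m - p ^ m) ≤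
      A * (q - p) * ((x ^ m - p ^ m) * (q ^ m - x ^ m)) * (1 - x) ^ 2 := by
    have := mul_le_mul_of_nonneg_right houter
      (by positivity : 0 ≤ (1 - x) ^ 2 * ((1 - p) * (1 - q)))
    field_simp at this
    linarith
  have hmul := mul_le_mul_of_nonneg_right houter' (by linarith : 0 ≤ q - p)
  have hfin : ((q - p) * (x - p) * (q - x)) * (q ^ m - p ^ m) * 1 ≤
      ((q - p) * (x - p) * (q - x)) * (q ^ m - p ^ m) * (A * B * (1 - x) ^ 2) := by
    have := mul_le_mul_of_nonneg_left hinner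
      (mul_nonneg (mul_nonneg hA0 (sq_nonneg (1 - x))) (by linarith : 0 ≤ q - p))
    linarith
  exact le_of_mul_le_mul_left hfin (mul_pos hs hr)

theorem stmt_16 (k Δ : ℕ) (hk : 2 ≤ k) (hΔ : 2 ≤ Δ)
    (f : ℝ → ℝ)
    (hf : ∀ z : ℝ,
      f z = (1 - z ^ (k - 1)) ^ (Δ - 1) / (1 + (1 - z ^ (k - 1)) ^ (Δ - 1))) :
    StrictAntiOn f (Set.Icc 0 1) ∧
    ∃ x : ℝ, x ∈ Set.Ioo (0 : ℝ) 1 ∧ f x = x ∧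
      (∀ z ∈ Set.Icc (0 : ℝ) 1, f z = z → z = x) ∧
      |deriv f x| = ((Δ : ℝ) - 1) * ((k : ℝ) - 1) * x ^ (k - 1) * (1 - x) /
        (1 - x ^ (k - 1)) ∧
      (|deriv f x| < 1 → ∀ z ∈ Set.Icc (0 : ℝ) 1, f (f z) = z → z = x) := by
  obtain ⟨m, rfl⟩ : ∃ m, k = m + 1 := ⟨k - 1, by omega⟩
  obtain ⟨d, rfl⟩ : ∃ d, Δ = d + 1 := ⟨Δ - 1, by omega⟩
  have hm : m ≠ 0 := by omega
  have hd : d ≠ 0 := by omega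
  simp only [Nat.add_sub_cancel, Nat.cast_add, Nat.cast_one, add_sub_cancel_right] at hf ⊢
  have hu {z : ℝ} (hz : z ∈ Set.Icc (0 : ℝ) 1) : 0 ≤ 1 - z ^ m :=
    sub_nonneg.mpr (pow_le_one₀ hz.1 hz.2)
  have hh {z : ℝ} (hz : z ∈ Set.Icc (0 : ℝ) 1) : 0 ≤ (1 - z ^ m) ^ d := pow_nonneg (hu hz) d
  have hanti : StrictAntiOn f (Set.Icc 0 1) := by
    intro a ha b hb hab
    have h1 : (1 - b ^ m) ^ d < (1 - a ^ m) ^ d :=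
      pow_lt_pow_left₀ (sub_lt_sub_left (pow_lt_pow_left₀ hab ha.1 hm) 1) (hu hb) hd
    have := hh ha
    have := hh hb
    rw [hf, hf, div_lt_div_iff₀ (by positivity) (by positivity)]
    linarith
  have hcont : ContinuousOn f (Set.Icc 0 1) := by
    rw [funext hf]
    refine ContinuousOn.div (by fun_prop) (by fun_prop) fun z hz => ?_
    have := hh hz
    positivity
  have hf0 : f 0 = 1 / 2 := by rw [hf]; norm_num [hm]
  have hf1 : f 1 = 0 := by rw [hf]; simp [hd]
  have hmaps {z : ℝ} (hz : z ∈ Set.Icc (0 : ℝ) 1) : 0 ≤ f z ∧ f z < 1 := by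
    have := hh hz
    rw [hf, div_lt_one (by positivity)]
    exact ⟨by positivity, by linarith⟩
  have hval {z : ℝ} (hz : z ∈ Set.Icc (0 : ℝ) 1) : (1 - z ^ m) ^ d = f z / (1 - f z) := by
    have := hh hz
    have h1 : 0 < 1 - f z := by linarith [(hmaps hz).2]
    rw [eq_div_iff h1.ne', hf]
    field_simp
    ring
  obtain ⟨x, hxI, hx0⟩ : (0 : ℝ) ∈ (fun z => f z - z) '' Set.Icc 0 1 :=
    intermediate_value_Icc' zero_le_one (hcont.sub continuousOn_id) (by norm_num [hf0, hf1])
  have hfx : f x = x := sub_eq_zero.mp hx0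
  have hxpos : 0 < x := by
    refine hxI.1.lt_of_ne fun h => ?_
    rw [← h, hf0] at hfx
    norm_num at hfx
  have hx1 : x < 1 := hfx ▸ (hmaps hxI).2
  have huniq : ∀ z ∈ Set.Icc (0 : ℝ) 1, f z = z → z = x := by
    intro z hz hfz
    rcases lt_trichotomy z x with h | h | h
    · linarith [hanti hz hxI h]
    · exact h
    · linarith [hanti hxI hz h]
  have hU : 0 < 1 - x ^ m := sub_pos.mpr (pow_lt_one₀ hxpos.le hx1 hm)
  have h1x : 0 < 1 - x := by linarith
  have hvx : (1 - x ^ m) ^ d = x / (1 - x) := by simpa only [hfx] using hval hxI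
  have hderiv : |deriv f x| =
      (d * (1 - x ^ m) ^ (d - 1)) * (m * x ^ (m - 1)) * (1 - x) ^ 2 := by
    have hH : HasDerivAt (fun z : ℝ => (1 - z ^ m) ^ d)
        (d * (1 - x ^ m) ^ (d - 1) * -(m * x ^ (m - 1))) x :=
      ((hasDerivAt_pow m x).const_sub 1).fun_pow d
    have hne : 1 + (1 - x ^ m) ^ d ≠ 0 := by positivity
    have hF := hH.fun_div (hH.const_add 1) hne
    rw [← funext hf] at hF
    rw [hF.deriv, abs_of_nonpos]
    · rw [hvx]
      field_simp
      ring
    · refine div_nonpos_of_nonpos_of_nonneg ?_ (sq_nonneg _)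
      have : 0 ≤ d * (1 - x ^ m) ^ (d - 1) * (m * x ^ (m - 1)) := by positivity
      linarith
  refine ⟨hanti, x, ⟨hxpos, hx1⟩, hfx, huniq, ?_, ?_⟩
  · rw [hderiv, eq_div_iff hU.ne']
    have e1 : (1 - x ^ m) ^ (d - 1) * (1 - x ^ m) = x / (1 - x) := by
      rw [pow_sub_one_mul hd, hvx]
    have e2 : x ^ (m - 1) * x = x ^ m := pow_sub_one_mul hm x
    calc _ = (d * m * x ^ (m - 1) * (1 - x) ^ 2) * ((1 - x ^ m) ^ (d - 1) * (1 - x ^ m)) := by ring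
      _ = d * m * (x ^ (m - 1) * x) * (1 - x) := by rw [e1]; field_simp
      _ = _ := by rw [e2]
  · intro hlt
    have hcycle {p q : ℝ} (hp : p ∈ Set.Icc (0 : ℝ) 1) (hq : q ∈ Set.Icc (0 : ℝ) 1)
        (hpq : p < q) (hfp : f p = q) (hfq : f q = p) : False := by
      have hpx : p < x := by
        by_contra! h
        linarith [hanti.antitoneOn hxI hp h]
      have hxq : x < q := by
        by_contra! h
        linarith [hanti.antitoneOn hq hxI h]
      have := one_le_of_two_cycle hp.1 hpx hxq (hfp ▸ (hmaps hp).2) hm hvx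
        (by simpa only [hfp] using hval hp) (by simpa only [hfq] using hval hq)
      linarith
    intro z hz hffz
    have hy : f z ∈ Set.Icc (0 : ℝ) 1 := ⟨(hmaps hz).1, (hmaps hz).2.le⟩
    rcases lt_trichotomy z (f z) with h | h | h
    · exact (hcycle hz hy h rfl hffz).elim
    · exact huniq z hz h.symm
    · exact (hcycle hy hz h hffz rfl).elim
end

section
/- Let k ≥ 2 be an integer and let Δ be an integer with Δ ≥ 5·2^{k/2} (where 2^{k/2} denotes the real power). Then 2^{⌈k/2⌉} - 1 < (Δ-2)^Δ / (Δ-1)^{Δ-1}. -/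
theorem two_zpow_ceil_half_le (k : ℕ) :
    (2 : ℝ) ^ ⌈(k : ℝ) / 2⌉ ≤ √2 * (2 : ℝ) ^ ((k : ℝ) / 2) := by
  have h_ceil : 2 * ⌈(k : ℝ) / 2⌉ < (k : ℤ) + 2 := by
    have h := Int.ceil_lt_add_one ((k : ℝ) / 2)
    have : 2 * (⌈(k : ℝ) / 2⌉ : ℝ) < (k : ℝ) + 2 := by linarith
    exact_mod_cast this
  have h_le : 2 * ⌈(k : ℝ) / 2⌉ ≤ (k : ℤ) + 1 := by omega
  have h_real : 2 * (⌈(k : ℝ) / 2⌉ : ℝ) ≤ (k : ℝ) + 1 := by exact_mod_cast h_le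
  rw [Real.sqrt_eq_rpow, ← Real.rpow_add two_pos, ← Real.rpow_intCast]
  exact Real.rpow_le_rpow_of_exponent_le one_le_two (by linarith)

theorem add_one_pow_le_exp_one_mul_pow {n : ℕ} (hn : 0 < n) :
    ((n : ℝ) + 1) ^ n ≤ Real.exp 1 * (n : ℝ) ^ n := by
  have hn' : (0 : ℝ) < n := by exact_mod_cast hn
  have h_base : (n : ℝ) + 1 ≤ Real.exp (1 / n) * n := by
    have h := mul_le_mul_of_nonneg_right (Real.add_one_le_exp (1 / (n : ℝ))) hn'.le
    rwa [add_mul, one_div_mul_cancel hn'.ne', one_mul, add_comm] at h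
  calc ((n : ℝ) + 1) ^ n ≤ (Real.exp (1 / n) * n) ^ n := by gcongr
    _ = Real.exp 1 * (n : ℝ) ^ n := by
      rw [mul_pow, ← Real.exp_nat_mul, mul_one_div_cancel hn'.ne']

theorem stmt_19 (k Δ : ℕ) (hk : 2 ≤ k)
    (hΔ : 5 * (2 : ℝ) ^ ((k : ℝ) / 2) ≤ (Δ : ℝ)) :
    (2 : ℝ) ^ ⌈(k : ℝ) / 2⌉ - 1 < ((Δ : ℝ) - 2) ^ Δ / ((Δ : ℝ) - 1) ^ (Δ - 1) := by
  have h_two : (2 : ℝ) ≤ (2 : ℝ) ^ ((k : ℝ) / 2) := by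
    have hk' : (2 : ℝ) ≤ k := by exact_mod_cast hk
    exact Real.self_le_rpow_of_one_le one_le_two (by linarith)
  have h_ten : 10 ≤ Δ := by
    have : (10 : ℝ) ≤ Δ := by linarith
    exact_mod_cast this
  have h_sqrt : √2 ≤ 1.5 := by
    rw [Real.sqrt_le_left (by norm_num)]
    norm_num
  have h_lhs : (2 : ℝ) ^ ⌈(k : ℝ) / 2⌉ ≤ 0.3 * Δ := by
    have := two_zpow_ceil_half_le k
    nlinarith
  obtain ⟨n, rfl⟩ : ∃ n, Δ = n + 2 := ⟨Δ - 2, by omega⟩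
  have hn : (8 : ℝ) ≤ n := by
    have : 8 ≤ n := by omega
    exact_mod_cast this
  have h_pow := add_one_pow_le_exp_one_mul_pow (n := n) (by omega)
  have h_num : ((n + 2 : ℕ) : ℝ) - 2 = n := by push_cast; ring
  have h_den : ((n + 2 : ℕ) : ℝ) - 1 = n + 1 := by push_cast; ring
  rw [h_num, h_den, show n + 2 - 1 = n + 1 by omega, lt_div_iff₀ (by positivity)]
  push_cast at h_lhs
  have h_exp := Real.exp_one_lt_d9
  have h_quad : (0.3 * ((n : ℝ) + 2) - 1) * (n + 1) * Real.exp 1 < (n : ℝ) ^ 2 := by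
    have h_nonneg : 0 < (0.3 * ((n : ℝ) + 2) - 1) * (n + 1) :=
      mul_pos (by linarith) (by linarith)
    nlinarith
  calc ((2 : ℝ) ^ ⌈(k : ℝ) / 2⌉ - 1) * ((n : ℝ) + 1) ^ (n + 1)
      ≤ (0.3 * ((n : ℝ) + 2) - 1) * ((n : ℝ) + 1) ^ (n + 1) := by gcongr
    _ = (0.3 * ((n : ℝ) + 2) - 1) * (n + 1) * ((n : ℝ) + 1) ^ n := by ring
    _ ≤ (0.3 * ((n : ℝ) + 2) - 1) * (n + 1) * (Real.exp 1 * (n : ℝ) ^ n) :=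
      mul_le_mul_of_nonneg_left h_pow (mul_nonneg (by linarith) (by linarith))
    _ = (0.3 * ((n : ℝ) + 2) - 1) * (n + 1) * Real.exp 1 * (n : ℝ) ^ n := by ring
    _ < (n : ℝ) ^ 2 * (n : ℝ) ^ n := by gcongr
    _ = (n : ℝ) ^ (n + 2) := by ring
end
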